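/- arXiv:math/0505067 — 3 statements merged into one kernel-verified Lean document; each statement's English description precedes it below -/
import Mathlib

section
/- The arithmetical rank of V equals n+1; that is, there exist n+1 polynomials in K[x_1,…,x_n,y_1,…,y_n] whose common zero set in K^{2n} is exactly V, and there do not exist n polynomials in K[x_1,…,x_n,y_1,…,y_n] whose common zero set in K^{2n} is V. -/
open MvPolynomial

/-- The parametrization map `φ : K^n → K^{2n}` of the toric variety `V`:
the first `n` coordinates (indexed by `Sum.inl`) are `x_1 = u_1^{d_1}, …,
x_{n-1} = u_{n-1}^{d_{n-1}}, x_n = u_n`, and the last `n` coordinates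
(indexed by `Sum.inr`) are `y_i = u_i^{f_i} u_n^{g_i}` for `i < n` and
`y_n = u_1^{h_1} ⋯ u_{n-1}^{h_{n-1}}`. -/
noncomputable def phiMap {K : Type*} [Field K] (n : ℕ)
    (d f g h : Fin (n - 1) → ℕ) (u : Fin n → K) : Fin n ⊕ Fin n → K :=
  Sum.elim
    (fun i => if hi : i.1 < n - 1 then u i ^ d ⟨i.1, hi⟩ else u i)
    (fun i =>
      if hi : i.1 < n - 1 then
        u i ^ f ⟨i.1, hi⟩ * u ⟨n - 1, by have := i.isLt; omega⟩ ^ g ⟨i.1, hi⟩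
      else ∏ j : Fin (n - 1), u (Fin.castLE (by omega) j) ^ h j)


section CMPart

universe u

open RingTheory.Sequence CategoryTheory Abelian Pointwise IsLocalRing

/-- The depth is bounded by the dimension of `R ⧸ P` for each associated prime `P`. -/
theorem cm_length_le_dim {R : Type u} [CommRing R] [IsNoetherianRing R] [IsLocalRing R]
    (rs : List R) (hrs : ∀ r ∈ rs, r ∈ maximalIdeal R) :
    ∀ (M : Type u) [AddCommGroup M] [Module R M] [Module.Finite R M],
      IsWeaklyRegular M rs → ∀ P ∈ associatedPrimes R M,
        (rs.length : WithBot ℕ∞) ≤ ringKrullDim (R ⧸ P) := by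
  induction rs with
  | nil =>
    intro M _ _ _ _ P hP
    have : P.IsPrime := hP.1
    simpa using ringKrullDim_nonneg_of_nontrivial
  | cons x rs ih =>
    intro M _ _ _ hreg P hP
    have hPp : P.IsPrime := hP.1
    rw [isWeaklyRegular_cons_iff] at hreg
    obtain ⟨hx, hreg⟩ := hreg
    have hxm : x ∈ maximalIdeal R := hrs x (by simp)
    obtain ⟨-, m₀, hm₀⟩ := (isAssociatedPrime_iff).1 hP
    have hm₀' : ∀ r, r ∈ P ↔ r • m₀ = 0 := by
      intro r
      rw [hm₀, Submodule.mem_colon_singleton, Submodule.mem_bot]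
    have hm₀ne : m₀ ≠ 0 := by
      rintro rfl
      exact hPp.ne_top ((Ideal.eq_top_iff_one _).2 ((hm₀' 1).2 (by simp)))
    have hxP : x ∉ P := by
      intro h
      exact hm₀ne (hx (by simpa using (hm₀' x).1 h))
    let U : Submodule R M := Submodule.torsionBySet R M P
    have hU : ∀ v, v ∈ U ↔ ∀ a ∈ P, a • v = 0 := by
      intro v
      simp [U, Submodule.mem_torsionBySet_iff]
    have hnot : ¬ U ≤ x • (⊤ : Submodule R M) := by
      intro hle
      have hle' : U ≤ Ideal.span {x} • U := by
        intro v hv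
        obtain ⟨w, -, rfl⟩ := (Submodule.mem_smul_pointwise_iff_exists _ _ _).1 (hle hv)
        refine Submodule.smul_mem_smul (Ideal.subset_span rfl) ?_
        rw [hU] at hv ⊢
        intro a ha
        have := hv a ha
        rw [smul_comm] at this
        exact hx (by simpa using this)
      have := Submodule.eq_bot_of_le_smul_of_le_jacobson_bot (Ideal.span {x}) U
        (IsNoetherian.noetherian _) hle' (by
          rw [IsLocalRing.jacobson_eq_maximalIdeal ⊥ bot_ne_top]
          simpa [Ideal.span_singleton_le_iff_mem] using hxm)
      have h0 : m₀ ∈ U := (hU m₀).2 fun a ha => (hm₀' a).1 ha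
      rw [this] at h0
      exact hm₀ne (by simpa using h0)
    obtain ⟨v, hvU, hvx⟩ := Set.not_subset.1 hnot
    have hv0 : (Submodule.Quotient.mk v : QuotSMulTop x M) ≠ 0 := by
      rw [Ne, Submodule.Quotient.mk_eq_zero]; exact hvx
    obtain ⟨Q, hQ, hvQ⟩ := exists_le_isAssociatedPrime_of_isNoetherianRing R _ hv0
    have hQp : Q.IsPrime := hQ.1
    have hPQ : P ≤ Q := by
      intro a ha
      apply hvQ
      rw [Submodule.mem_colon_singleton, Submodule.mem_bot, ← Submodule.Quotient.mk_smul,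
        (hU v).1 hvU a ha, Submodule.Quotient.mk_zero]
    have hxQ : x ∈ Q := by
      apply hvQ
      rw [Submodule.mem_colon_singleton, Submodule.mem_bot, ← Submodule.Quotient.mk_smul,
        Submodule.Quotient.mk_eq_zero]
      exact Submodule.smul_mem_pointwise_smul _ _ _ trivial
    have h1 := ih (fun r hr => hrs r (by simp [hr])) (QuotSMulTop x M) hreg Q hQ
    have h2 := ringKrullDim_succ_le_of_surjective (Ideal.Quotient.factor hPQ)
      (Ideal.Quotient.factor_surjective hPQ) (r := Ideal.Quotient.mk P x)
      (by
        rw [mem_nonZeroDivisors_iff_ne_zero, Ne, Ideal.Quotient.eq_zero_iff_mem]; exact hxP)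
      (by simpa [Ideal.Quotient.eq_zero_iff_mem] using hxQ)
    refine le_trans ?_ h2
    push_cast [List.length_cons]
    gcongr

/-- Krull's height theorem bound for quotients of local rings. -/
theorem cm_dim_le_length {R : Type u} [CommRing R] [IsNoetherianRing R] [IsLocalRing R]
    (P : Ideal R) [P.IsPrime] (rs : List R)
    (h : maximalIdeal R ≤ (P ⊔ Ideal.ofList rs).radical) (hrs : ∀ r ∈ rs, r ∈ maximalIdeal R) :
    ringKrullDim (R ⧸ P) ≤ (rs.length : WithBot ℕ∞) := by
  have : IsLocalRing (R ⧸ P) :=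
    IsLocalRing.of_surjective' (Ideal.Quotient.mk P) Ideal.Quotient.mk_surjective
  rw [← IsLocalRing.maximalIdeal_height_eq_ringKrullDim]
  classical
  let s : Finset (R ⧸ P) := (rs.map (Ideal.Quotient.mk P)).toFinset
  have hs : s.card ≤ rs.length := by
    simpa [s] using List.toFinset_card_le (rs.map (Ideal.Quotient.mk P))
  have hmap : (maximalIdeal (R ⧸ P)).comap (Ideal.Quotient.mk P) = maximalIdeal R := by
    have : ((maximalIdeal (R ⧸ P)).comap (Ideal.Quotient.mk P)).IsMaximal :=
      Ideal.comap_isMaximal_of_surjective _ Ideal.Quotient.mk_surjective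
    exact IsLocalRing.eq_maximalIdeal this
  have hmin : maximalIdeal (R ⧸ P) ∈ (Ideal.span (s : Set (R ⧸ P))).minimalPrimes := by
    refine ⟨⟨inferInstance, ?_⟩, ?_⟩
    · rw [Ideal.span_le]
      intro y hy
      simp only [s, List.coe_toFinset, Set.mem_ofPred_eq, List.mem_map] at hy
      obtain ⟨r, hr, rfl⟩ := hy
      have := hrs r hr
      rw [← hmap] at this
      exact this
    · rintro Q ⟨hQ, hsQ⟩ -
      have h1 : maximalIdeal R ≤ Q.comap (Ideal.Quotient.mk P) := by
        refine h.trans ?_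
        have hp : (Q.comap (Ideal.Quotient.mk P)).IsPrime := inferInstance
        rw [hp.radical_le_iff]
        refine sup_le ?_ ?_
        · intro a ha
          rw [Ideal.mem_comap, Ideal.Quotient.eq_zero_iff_mem.2 ha]
          exact Q.zero_mem
        · rw [Ideal.ofList, Ideal.span_le]
          intro r hr
          apply hsQ
          apply Ideal.subset_span
          simp only [s, List.coe_toFinset, Set.mem_ofPred_eq, List.mem_map]
          exact ⟨r, hr, rfl⟩
      intro y hy
      obtain ⟨r, rfl⟩ := Ideal.Quotient.mk_surjective y
      apply h1
      rw [← hmap]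
      exact hy
  have := Ideal.height_le_card_of_mem_minimalPrimes_span_finset hmin
  have h3 : (maximalIdeal (R ⧸ P)).height ≤ (rs.length : ℕ∞) :=
    this.trans (by exact_mod_cast hs)
  exact_mod_cast h3

/-- Systems of parameters are regular sequences when the depth is large enough. -/
theorem cm_sop_regular_aux {R : Type u} [CommRing R] [IsNoetherianRing R] [IsLocalRing R]
    (F : List R) (hF : ∀ r ∈ F, r ∈ maximalIdeal R) :
    ∀ (M : ModuleCat.{u} R) [Module.Finite R M],
      (∀ i < F.length,
        Subsingleton (Ext (ModuleCat.of R (R ⧸ maximalIdeal R)) M i)) →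
      maximalIdeal R ≤ (Module.annihilator R M ⊔ Ideal.ofList F).radical →
      IsWeaklyRegular M F := by
  induction F with
  | nil => intro M _ _ _; exact IsWeaklyRegular.nil R M
  | cons x F ih =>
    intro M _ hext hrad
    have hxm : x ∈ maximalIdeal R := hF x (by simp)
    have hFm : ∀ r ∈ F, r ∈ maximalIdeal R := fun r hr => hF r (by simp [hr])
    have hxreg : IsSMulRegular M x := by
      by_contra hcon
      have hx' : x ∈ ⋃ p ∈ associatedPrimes R M, (p : Set R) := by
        rw [biUnion_associatedPrimes_eq_compl_regular]
        exact hcon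
      simp only [Set.mem_iUnion] at hx'
      obtain ⟨P, hP, hxP⟩ := hx'
      have hxP : x ∈ P := hxP
      have hPp : P.IsPrime := hP.1
      have hPann : Module.annihilator R M ≤ P := by
        obtain ⟨-, m₀, hm₀⟩ := (isAssociatedPrime_iff).1 hP
        intro r hr
        rw [hm₀, Submodule.mem_colon_singleton, Submodule.mem_bot]
        exact Module.mem_annihilator.1 hr m₀
      have hnt : Nontrivial M := by
        by_contra hn
        rw [not_nontrivial_iff_subsingleton] at hn
        rw [associatedPrimes.eq_empty_of_subsingleton] at hP
        exact hP
      have hlt : maximalIdeal R • (⊤ : Submodule R M) < ⊤ := by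
        refine lt_top_iff_ne_top.2 ?_
        exact (Submodule.top_ne_ideal_smul_of_le_jacobson_annihilator
          (IsLocalRing.maximalIdeal_le_jacobson _)).symm
      have hsupp : Module.support R (ModuleCat.of R (R ⧸ maximalIdeal R)) =
          PrimeSpectrum.zeroLocus (maximalIdeal R) := by
        rw [Module.support_eq_zeroLocus]
        congr 1
        exact congrArg _ (Ideal.annihilator_quotient)
      obtain ⟨rs, hlen, hmem, hreg⟩ := ModuleCat.exists_isRegular_of_exists_subsingleton_ext
        (maximalIdeal R) (x :: F).length M hlt
        (ModuleCat.of R (R ⧸ maximalIdeal R)) hsupp hext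
      have h1 := cm_length_le_dim rs hmem M hreg.1 P hP
      have h2 := cm_dim_le_length P F (by
        refine hrad.trans (Ideal.radical_mono ?_)
        rw [Ideal.ofList_cons]
        refine sup_le (hPann.trans le_sup_left) (sup_le ?_ le_sup_right)
        refine le_trans ?_ le_sup_left
        simpa [Ideal.span_singleton_le_iff_mem] using hxP) hFm
      have h3 := h1.trans h2
      rw [hlen] at h3
      have h4 : (x :: F).length ≤ F.length := by exact_mod_cast h3
      simp at h4
    rw [isWeaklyRegular_cons_iff]
    refine ⟨hxreg, ?_⟩
    refine ih hFm (ModuleCat.of R (QuotSMulTop x M)) ?_ ?_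
    · intro i hi
      have zero1 := AddCommGrpCat.isZero_of_iff_subsingleton.mpr
        (hext i (by simp only [List.length_cons]; omega))
      have zero2 := AddCommGrpCat.isZero_of_iff_subsingleton.mpr
        (hext (i + 1) (by simp only [List.length_cons]; omega))
      exact AddCommGrpCat.subsingleton_of_isZero <| ShortComplex.Exact.isZero_of_both_zeros
        ((Ext.covariant_sequence_exact₃' (ModuleCat.of R (R ⧸ maximalIdeal R))
          hxreg.smulShortComplex_shortExact) i (i + 1) rfl)
        (zero1.eq_zero_of_src _) (zero2.eq_zero_of_tgt _)
    · refine hrad.trans (Ideal.radical_mono ?_)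
      rw [Ideal.ofList_cons]
      refine sup_le ?_ (sup_le ?_ le_sup_right)
      · refine le_trans ?_ le_sup_left
        exact LinearMap.annihilator_le_of_surjective (Submodule.mkQ (x • (⊤ : Submodule R M)))
          (Submodule.mkQ_surjective _)
      · refine le_trans ?_ le_sup_left
        rw [Ideal.span_singleton_le_iff_mem, Module.mem_annihilator]
        intro m
        obtain ⟨m, rfl⟩ := Submodule.Quotient.mk_surjective _ m
        rw [← Submodule.Quotient.mk_smul, Submodule.Quotient.mk_eq_zero]
        exact Submodule.smul_mem_pointwise_smul _ _ _ trivial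

/-- In a noetherian local ring with a regular sequence of length `s`, any `s` elements
generating an ideal primary to the maximal ideal form a regular sequence. -/
theorem cm_sop_regular {R : Type u} [CommRing R] [IsNoetherianRing R] [IsLocalRing R]
    (F rs : List R) (hF : ∀ r ∈ F, r ∈ maximalIdeal R)
    (hrs : ∀ r ∈ rs, r ∈ maximalIdeal R) (hreg : IsRegular R rs) (hlen : F.length = rs.length)
    (hrad : maximalIdeal R ≤ (Ideal.ofList F).radical) : IsWeaklyRegular R F := by
  have := cm_sop_regular_aux F hF (ModuleCat.of R R) (by
    rw [hlen]
    refine ModuleCat.subsingleton_ext_of_exists_isRegular (maximalIdeal R) _ ?_ _ ?_ rs hrs hreg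
    · rw [Module.support_eq_zeroLocus]
      apply PrimeSpectrum.zeroLocus_anti_mono
      exact (Ideal.annihilator_quotient).ge
    · refine lt_top_iff_ne_top.2 ?_
      exact (Submodule.top_ne_ideal_smul_of_le_jacobson_annihilator
          (IsLocalRing.maximalIdeal_le_jacobson _)).symm)
    (hrad.trans (Ideal.radical_mono le_sup_right))
  exact this

end CMPart

section PolyPart

universe u v

open RingTheory.Sequence Pointwise IsLocalRing

/-- Distinct variables form a weakly regular sequence in a polynomial ring. -/
theorem vars_weaklyRegular {σ : Type u} {K : Type v} [Field K] (l : List σ) (hl : l.Nodup) :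
    IsWeaklyRegular (MvPolynomial σ K) (l.map (X : σ → MvPolynomial σ K)) := by
  refine ⟨fun i hi => ?_⟩
  rw [isSMulRegular_quotient_iff_mem_of_smul_mem]
  have hi' : i < l.length := by simpa using hi
  have hset : (Ideal.ofList ((l.map (X : σ → MvPolynomial σ K)).take i) • ⊤ :
      Submodule (MvPolynomial σ K) (MvPolynomial σ K)) =
      Ideal.span ((X : σ → MvPolynomial σ K) '' {j | j ∈ l.take i}) := by
    rw [smul_eq_mul, Ideal.mul_top, Ideal.ofList]
    congr 1
    ext y
    simp [← List.map_take]
  rw [hset]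
  intro f hf
  rw [mem_ideal_span_X_image] at hf ⊢
  intro m hm
  have hget : (l.map (X : σ → MvPolynomial σ K))[i] = X l[i] := by simp
  rw [hget, smul_eq_mul] at hf
  obtain ⟨j, hj, hmj⟩ := hf (Finsupp.single l[i] 1 + m) (by
    rw [mem_support_iff] at hm ⊢
    rwa [coeff_X_mul])
  refine ⟨j, hj, ?_⟩
  have hne : l[i] ≠ j := by
    rintro rfl
    have hj' : l[i] ∈ l.take i := hj
    rw [List.mem_take_iff_getElem] at hj'
    obtain ⟨k, hk, hkk⟩ := hj'
    have := (List.Nodup.getElem_inj_iff hl).1 hkk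
    omega
  simpa [Finsupp.single_apply, hne] using hmj

/-- Translation of polynomials. -/
noncomputable def shiftEquiv {σ : Type u} {K : Type v} [Field K] (o : σ → K) :
    MvPolynomial σ K ≃ₐ[K] MvPolynomial σ K :=
  AlgEquiv.ofAlgHom (aeval fun i => X i - C (o i)) (aeval fun i => X i + C (o i))
    (by ext i; simp) (by ext i; simp)

theorem shifted_vars_weaklyRegular {σ : Type u} {K : Type v} [Field K] (o : σ → K)
    (l : List σ) (hl : l.Nodup) :
    IsWeaklyRegular (MvPolynomial σ K)
      (l.map (fun i => (X i - C (o i) : MvPolynomial σ K))) := by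
  refine (AddEquiv.isWeaklyRegular_congr (e := (shiftEquiv o).toAddEquiv) ?_).1
    (vars_weaklyRegular (K := K) l hl)
  rw [List.forall₂_map_left_iff, List.forall₂_map_right_iff, List.forall₂_same]
  intro i _ x
  simp [shiftEquiv]

/-- If `#σ` polynomials have `o` as only common zero, they form a regular sequence in the
local ring at `o`. -/
theorem sop_weaklyRegular {σ : Type u} {K : Type v} [Fintype σ] [Field K] [IsAlgClosed K] (o : σ → K)
    (m : Ideal (MvPolynomial σ K)) [m.IsPrime] (hm : ∀ f, f ∈ m ↔ eval o f = 0)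
    (G : List (MvPolynomial σ K)) (hlen : G.length = Fintype.card σ)
    (hG : ∀ w, (∀ f ∈ G, eval w f = 0) ↔ w = o) :
    IsWeaklyRegular (Localization.AtPrime m)
      (G.map (algebraMap (MvPolynomial σ K) (Localization.AtPrime m))) := by
  have hloc : ∀ f ∈ m, algebraMap (MvPolynomial σ K) (Localization.AtPrime m) f ∈
      maximalIdeal (Localization.AtPrime m) := by
    intro f hf
    exact (IsLocalization.AtPrime.to_map_mem_maximal_iff _ m f).2 hf
  have : IsNoetherianRing (Localization.AtPrime m) :=
    IsLocalization.isNoetherianRing m.primeCompl _ inferInstance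
  have hreg : IsRegular (Localization.AtPrime m)
      (((Finset.univ : Finset σ).toList.map
        (fun i => (X i - C (o i) : MvPolynomial σ K))).map
        (algebraMap (MvPolynomial σ K) (Localization.AtPrime m))) := by
    refine IsWeaklyRegular.isRegular_of_isLocalization_of_mem _ m
      (shifted_vars_weaklyRegular o _ (Finset.nodup_toList _)) ?_
    intro r hr
    obtain ⟨i, -, rfl⟩ := List.mem_map.1 hr
    rw [hm]; simp
  refine cm_sop_regular _ _ ?_ ?_ hreg ?_ ?_
  · intro r hr
    obtain ⟨f, hf, rfl⟩ := List.mem_map.1 hr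
    exact hloc f ((hm f).2 ((hG o).2 rfl f hf))
  · intro r hr
    obtain ⟨f, hf, rfl⟩ := List.mem_map.1 hr
    obtain ⟨i, -, rfl⟩ := List.mem_map.1 hf
    apply hloc
    rw [hm]; simp
  · simp [hlen]
  · rw [← Localization.AtPrime.map_eq_maximalIdeal, ← Ideal.map_ofList]
    refine le_trans (Ideal.map_mono ?_) (Ideal.map_radical_le _)
    intro f hf
    rw [← vanishingIdeal_zeroLocus_eq_radical (K := K), mem_vanishingIdeal_iff]
    intro w hw
    rw [Ideal.ofList, zeroLocus_span] at hw
    have : w = o := (hG w).1 (fun f hf => by simpa [aeval_eq_eval] using hw f hf)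
    subst this
    simpa [aeval_eq_eval] using (hm f).1 hf

theorem add_pow_split {R : Type u} [CommRing R] (a b : R) (M : ℕ) :
    ∃ r s : R, (a + b) ^ (M + M) = a ^ M * r + b ^ M * s := by
  have h : (a + b) ^ (M + M) ∈ (Ideal.span {a} ⊔ Ideal.span {b}) ^ (M + M) := by
    apply Ideal.pow_mem_pow
    exact Submodule.add_mem_sup (Ideal.mem_span_singleton_self a) (Ideal.mem_span_singleton_self b)
  have h2 := Ideal.sup_pow_add_le_pow_sup_pow h
  rw [Ideal.span_singleton_pow, Ideal.span_singleton_pow, Submodule.mem_sup] at h2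
  obtain ⟨x, hx, y, hy, hxy⟩ := h2
  obtain ⟨r, rfl⟩ := Ideal.mem_span_singleton'.1 hx
  obtain ⟨s, rfl⟩ := Ideal.mem_span_singleton'.1 hy
  exact ⟨r, s, by rw [← hxy]; ring⟩

/-- A form of Hartshorne's connectedness theorem. -/
theorem connectedness {σ : Type u} {K : Type v} [Fintype σ] [Field K] [IsAlgClosed K] (o : σ → K)
    (F : List (MvPolynomial σ K)) (hlen : F.length + 2 = Fintype.card σ)
    (a b a' b' : MvPolynomial σ K)
    (hab : ∀ w, (∀ f ∈ F, eval w f = 0) → eval w (a * b) = 0)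
    (hab' : ∀ w, (∀ f ∈ F, eval w f = 0) → eval w (a * b') = 0)
    (ha'b : ∀ w, (∀ f ∈ F, eval w f = 0) → eval w (a' * b) = 0)
    (hZ : ∀ w, ((∀ f ∈ F, eval w f = 0) ∧ eval w (a + b) = 0 ∧ eval w (a' + b') = 0) ↔ w = o)
    (hA : ∀ s : MvPolynomial σ K, (∀ w, (∀ f ∈ F, eval w f = 0) → eval w b = 0 →
      eval w (a + b) ≠ 0 → eval w s = 0) → eval o s = 0)
    (hB : ∀ s : MvPolynomial σ K, (∀ w, (∀ f ∈ F, eval w f = 0) → eval w a = 0 →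
      eval w (a + b) ≠ 0 → eval w s = 0) → eval o s = 0) : False := by
  have hnull : ∀ f : MvPolynomial σ K, (∀ w, (∀ f ∈ F, eval w f = 0) → eval w f = 0) →
      ∃ N, f ^ N ∈ Ideal.ofList F := by
    intro f hf
    have : f ∈ (Ideal.ofList F).radical := by
      rw [← vanishingIdeal_zeroLocus_eq_radical (K := K), mem_vanishingIdeal_iff]
      intro w hw
      rw [Ideal.ofList, zeroLocus_span] at hw
      simpa [aeval_eq_eval] using hf w (fun f hf => by simpa [aeval_eq_eval] using hw f hf)
    exact this
  have hvan : ∀ f ∈ Ideal.ofList F, ∀ w, (∀ f ∈ F, eval w f = 0) → eval w f = 0 := by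
    intro f hf w hw
    have : Ideal.ofList F ≤ RingHom.ker (eval w) := by
      rw [Ideal.ofList, Ideal.span_le]
      intro f hf
      exact hw f hf
    exact this hf
  obtain ⟨N1, h1⟩ := hnull _ hab
  obtain ⟨N2, h2⟩ := hnull _ hab'
  obtain ⟨N3, h3⟩ := hnull _ ha'b
  obtain ⟨M, hM0, hM1, hM2, hM3⟩ : ∃ M, 0 < M ∧ N1 ≤ M ∧ N2 ≤ M ∧ N3 ≤ M :=
    ⟨N1 + N2 + N3 + 1, by omega, by omega, by omega, by omega⟩
  replace h1 := Ideal.mem_of_dvd _ (pow_dvd_pow _ hM1) h1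
  replace h2 := Ideal.mem_of_dvd _ (pow_dvd_pow _ hM2) h2
  replace h3 := Ideal.mem_of_dvd _ (pow_dvd_pow _ hM3) h3
  obtain ⟨r, s, hrs⟩ := add_pow_split a b M
  obtain ⟨r', s', hrs'⟩ := add_pow_split a' b' M
  let m : Ideal (MvPolynomial σ K) := RingHom.ker (eval o)
  have hm : ∀ f, f ∈ m ↔ eval o f = 0 := fun f => RingHom.mem_ker
  have hmp : m.IsPrime := RingHom.ker_isPrime _
  have hreg := sop_weaklyRegular o m hm (F ++ [(a + b) ^ (M + M), (a' + b') ^ (M + M)])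
    (by simpa using hlen) (by
      intro w
      rw [← hZ w]
      simp only [List.mem_append, List.mem_cons, List.not_mem_nil, or_false]
      constructor
      · intro h
        refine ⟨fun f hf => h f (Or.inl hf), ?_, ?_⟩
        · have := h _ (Or.inr (Or.inl rfl))
          rw [map_pow] at this
          exact pow_eq_zero_iff (by omega) |>.1 this
        · have := h _ (Or.inr (Or.inr rfl))
          rw [map_pow] at this
          exact pow_eq_zero_iff (by omega) |>.1 this
      · rintro ⟨h1, h2, h3⟩ f (hf | rfl | rfl)
        · exact h1 f hf
        · rw [map_pow, h2, zero_pow (by omega)]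
        · rw [map_pow, h3, zero_pow (by omega)])
  set L := Localization.AtPrime m
  let φ := algebraMap (MvPolynomial σ K) L
  let 𝔞 : Ideal L := Ideal.ofList (F.map φ)
  have h𝔞 : 𝔞 = (Ideal.ofList F).map φ := (Ideal.map_ofList _ _).symm
  have hmem : ∀ f ∈ Ideal.ofList F, φ f ∈ 𝔞 := by
    intro f hf
    rw [h𝔞]; exact Ideal.mem_map_of_mem _ hf
  have hR1 : ∀ z : L, φ ((a + b) ^ (M + M)) * z ∈ 𝔞 → z ∈ 𝔞 := by
    have := hreg.regular_mod_prev F.length (by simp)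
    rw [isSMulRegular_quotient_iff_mem_of_smul_mem] at this
    simpa [List.getElem_append, List.take_append, ← List.map_take] using this
  have hR2 : ∀ z : L, φ ((a' + b') ^ (M + M)) * z ∈ 𝔞 ⊔ Ideal.span {φ ((a + b) ^ (M + M))} →
      z ∈ 𝔞 ⊔ Ideal.span {φ ((a + b) ^ (M + M))} := by
    have := hreg.regular_mod_prev (F.length + 1) (by simp)
    rw [isSMulRegular_quotient_iff_mem_of_smul_mem] at this
    simpa [List.getElem_append, List.take_append, ← List.map_take, Ideal.ofList_append,
      List.take_of_length_le (Nat.le_succ F.length)] using this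
  have hαβ : φ (a ^ M * r) * φ (b ^ M * s) ∈ 𝔞 := by
    rw [← map_mul]
    apply hmem
    have : a ^ M * r * (b ^ M * s) = (r * s) * (a * b) ^ M := by ring
    rw [this]
    exact Ideal.mul_mem_left _ _ h1
  have hαβ' : φ (a ^ M * r) * φ (b' ^ M * s') ∈ 𝔞 := by
    rw [← map_mul]
    apply hmem
    have : a ^ M * r * (b' ^ M * s') = (r * s') * (a * b') ^ M := by ring
    rw [this]
    exact Ideal.mul_mem_left _ _ h2
  have hα'β : φ (a' ^ M * r') * φ (b ^ M * s) ∈ 𝔞 := by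
    rw [← map_mul]
    apply hmem
    have : a' ^ M * r' * (b ^ M * s) = (r' * s) * (a' * b) ^ M := by ring
    rw [this]
    exact Ideal.mul_mem_left _ _ h3
  have hs1 : φ ((a + b) ^ (M + M)) = φ (a ^ M * r) + φ (b ^ M * s) := by rw [hrs, map_add]
  have hs2 : φ ((a' + b') ^ (M + M)) = φ (a' ^ M * r') + φ (b' ^ M * s') := by rw [hrs', map_add]
  rw [hs1, hs2] at hR2
  rw [hs1] at hR1
  have hfin1 : φ (a ^ M * r) ∈ 𝔞 → False := by
    intro h
    rw [h𝔞, IsLocalization.algebraMap_mem_map_algebraMap_iff m.primeCompl] at h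
    obtain ⟨g, hg, hgm⟩ := h
    refine hg ((hm g).2 (hA g fun w hw hbw habw => ?_))
    have h5 := hvan _ hgm w hw
    have h6 : eval w (a ^ M * r) ≠ 0 := by
      have : eval w (a ^ M * r) = eval w ((a + b) ^ (M + M)) := by
        rw [hrs, map_add, map_mul _ (b ^ M), map_pow _ b, hbw, zero_pow hM0.ne']; simp
      rw [this, map_pow]
      exact pow_ne_zero _ habw
    rw [map_mul] at h5
    exact (mul_eq_zero.1 h5).resolve_right h6
  have hfin2 : φ (b ^ M * s) ∈ 𝔞 → False := by
    intro h
    rw [h𝔞, IsLocalization.algebraMap_mem_map_algebraMap_iff m.primeCompl] at h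
    obtain ⟨g, hg, hgm⟩ := h
    refine hg ((hm g).2 (hB g fun w hw hbw habw => ?_))
    have h5 := hvan _ hgm w hw
    have h6 : eval w (b ^ M * s) ≠ 0 := by
      have : eval w (b ^ M * s) = eval w ((a + b) ^ (M + M)) := by
        rw [hrs, map_add, map_mul _ (a ^ M), map_pow _ a, hbw, zero_pow hM0.ne']; simp
      rw [this, map_pow]
      exact pow_ne_zero _ habw
    rw [map_mul] at h5
    exact (mul_eq_zero.1 h5).resolve_right h6
  generalize φ (a ^ M * r) = α at *
  generalize φ (b ^ M * s) = β at *
  generalize φ (a' ^ M * r') = α' at *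
  generalize φ (b' ^ M * s') = β' at *
  have hα : α ∈ 𝔞 ⊔ Ideal.span {α + β} := by
    apply hR2
    have : (α' + β') * α = (α * β' - α' * β) + α' * (α + β) := by ring
    rw [this]
    exact Submodule.add_mem_sup (𝔞.sub_mem hαβ' hα'β)
      (Ideal.mul_mem_left _ _ (Ideal.mem_span_singleton_self _))
  obtain ⟨c, hc, y, hy, hcy⟩ := Submodule.mem_sup.1 hα
  obtain ⟨e, rfl⟩ := Ideal.mem_span_singleton'.1 hy
  have he : e * (1 - e) ∈ 𝔞 := by
    apply hR1
    apply hR1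
    have h7 : (α + β) * ((α + β) * (e * (1 - e))) = (α - c) * (β + c) := by
      have hx : e * (α + β) = α - c := by linear_combination hcy
      have hy' : (1 - e) * (α + β) = β + c := by linear_combination -hcy
      calc _ = (e * (α + β)) * ((1 - e) * (α + β)) := by ring
        _ = _ := by rw [hx, hy']
    rw [h7]
    have : (α - c) * (β + c) = α * β + c * (α - c - β) := by ring
    rw [this]
    exact 𝔞.add_mem hαβ (Ideal.mul_mem_right _ _ hc)
  rcases IsLocalRing.isUnit_or_isUnit_one_sub_self e with hu | hu
  · have h8 : 1 - e ∈ 𝔞 := (Ideal.unit_mul_mem_iff_mem _ hu).1 he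
    apply hfin2
    have : β = (1 - e) * (α + β) - c := by linear_combination hcy
    rw [this]
    exact 𝔞.sub_mem (Ideal.mul_mem_right _ _ h8) hc
  · have h8 : e ∈ 𝔞 := (Ideal.mul_unit_mem_iff_mem _ hu).1 he
    apply hfin1
    rw [← hcy]
    exact 𝔞.add_mem hc (Ideal.mul_mem_right _ _ h8)

end PolyPart

section LowerPart

universe u v

/-- The parametrization, with values in any commutative semiring. -/
def ptMap {R : Type v} [CommSemiring R] {N : ℕ} (d f g h : Fin N → ℕ) (u : Fin N → R) (t : R) :
    Fin (N + 1) ⊕ Fin (N + 1) → R :=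
  Sum.elim (Fin.snoc (fun i => u i ^ d i) t : Fin (N + 1) → R)
    (Fin.snoc (fun i => u i ^ f i * t ^ g i) (∏ i, u i ^ h i) : Fin (N + 1) → R)

section ptMapLemmas

variable {R : Type v} [CommSemiring R] {N : ℕ} (d f g h : Fin N → ℕ) (u : Fin N → R) (t : R)

theorem ptMap_x (i : Fin N) : ptMap d f g h u t (Sum.inl i.castSucc) = u i ^ d i := by
  simp [ptMap]

theorem ptMap_t : ptMap d f g h u t (Sum.inl (Fin.last N)) = t := by
  simp [ptMap]

theorem ptMap_y (i : Fin N) : ptMap d f g h u t (Sum.inr i.castSucc) = u i ^ f i * t ^ g i := by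
  simp [ptMap]

theorem ptMap_z : ptMap d f g h u t (Sum.inr (Fin.last N)) = ∏ i, u i ^ h i := by
  simp [ptMap]

theorem ptMap_ext (w w' : Fin (N + 1) ⊕ Fin (N + 1) → R)
    (h1 : ∀ i : Fin N, w (Sum.inl i.castSucc) = w' (Sum.inl i.castSucc))
    (h2 : w (Sum.inl (Fin.last N)) = w' (Sum.inl (Fin.last N)))
    (h3 : ∀ i : Fin N, w (Sum.inr i.castSucc) = w' (Sum.inr i.castSucc))
    (h4 : w (Sum.inr (Fin.last N)) = w' (Sum.inr (Fin.last N))) : w = w' := by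
  funext z
  rcases z with z | z
  · refine Fin.lastCases h2 h1 z
  · refine Fin.lastCases h4 h3 z

theorem ptMap_map {S : Type u} [CommSemiring S] (φ : R →+* S) (z) :
    φ (ptMap d f g h u t z) = ptMap d f g h (fun i => φ (u i)) (φ t) z := by
  have : (fun z => φ (ptMap d f g h u t z)) = ptMap d f g h (fun i => φ (u i)) (φ t) := by
    apply ptMap_ext <;> intros <;> simp [ptMap]
  exact congrFun this z

end ptMapLemmas

/-- The homogeneous geometric sum. -/
def geomQ {R : Type v} [CommSemiring R] (p : ℕ) (Y T : R) : R :=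
  ∑ a ∈ Finset.range p, Y ^ a * T ^ (p - 1 - a)

theorem geomQ_map {R : Type v} {S : Type u} [CommSemiring R] [CommSemiring S] (φ : R →+* S)
    (p : ℕ) (Y T : R) : φ (geomQ p Y T) = geomQ p (φ Y) (φ T) := by
  simp [geomQ]

theorem geomQ_mul {R : Type v} [CommSemiring R] (p : ℕ) (η T : R) :
    geomQ p (η * T) T = (∑ a ∈ Finset.range p, η ^ a) * T ^ (p - 1) := by
  rw [geomQ, Finset.sum_mul]
  refine Finset.sum_congr rfl fun a ha => ?_
  have ha := Finset.mem_range.1 ha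
  rw [mul_pow, mul_assoc, ← pow_add]
  congr 2
  omega

theorem geomQ_one {R : Type v} [CommSemiring R] (p : ℕ) (T : R) :
    geomQ p T T = p * T ^ (p - 1) := by
  have := geomQ_mul p 1 T
  simpa using this

theorem geomQ_zero {K : Type v} [Field K] (p : ℕ) (θ T : K) (hθ : θ ^ p = 1) (hθ1 : θ ≠ 1)
    (hp : p.Prime) (k : ℕ) (hk : p.Coprime k) : geomQ p (θ ^ k * T) T = 0 := by
  rw [geomQ_mul]
  have h1 : θ ^ k ≠ 1 := by
    intro h2
    apply hθ1
    have h3 := orderOf_dvd_of_pow_eq_one hθ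
    have h4 := orderOf_dvd_of_pow_eq_one h2
    have h5 := Nat.dvd_gcd h3 h4
    rw [hk.gcd_eq_one, Nat.dvd_one] at h5
    exact orderOf_eq_one_iff.1 h5
  have h6 := mul_geom_sum (θ ^ k) p
  rw [← pow_mul, mul_comm k p, pow_mul, hθ, one_pow, sub_self] at h6
  rw [(mul_eq_zero.1 h6).resolve_left (sub_ne_zero.2 h1), zero_mul]

theorem curve_limit {K : Type v} [Field K] [IsAlgClosed K] {N : ℕ} (d f g h : Fin N → ℕ)
    (u : Fin N → K) (s : MvPolynomial (Fin (N + 1) ⊕ Fin (N + 1)) K)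
    (hs : ∀ τ, τ ≠ 0 → eval (ptMap d f g h u τ) s = 0) : eval (ptMap d f g h u 0) s = 0 := by
  let q : Polynomial K :=
    aeval (ptMap d f g h (fun i => Polynomial.C (u i)) (Polynomial.X : Polynomial K)) s
  have hq : ∀ τ, q.eval τ = eval (ptMap d f g h u τ) s := by
    intro τ
    have : q.eval τ = Polynomial.aeval τ q := by simp
    rw [this, ← AlgHom.comp_apply, comp_aeval, aeval_eq_eval]
    congr 2
    funext z
    have := ptMap_map d f g h (fun i => Polynomial.C (u i)) Polynomial.X (Polynomial.evalRingHom τ) z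
    simpa using this
  have hX : Polynomial.X * q = 0 := by
    apply Polynomial.funext
    intro τ
    by_cases hτ : τ = 0
    · simp [hτ]
    · simp [hq, hs τ hτ]
  have : q = 0 := (mul_eq_zero.1 hX).resolve_left Polynomial.X_ne_zero
  rw [← hq, this, Polynomial.eval_zero]

theorem special_point {K : Type v} [Field K] {N : ℕ} (d f g h : Fin N → ℕ)
    (hd : ∀ i, 0 < d i) (hg : ∀ i, 0 < g i) (hh : ∀ i, 0 < h i)
    (j : Fin N) (u u' : Fin N → K) (hj : u j = 0) (hu : ∀ k, k ≠ j → u k ^ d k = 1)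
    (hj' : u' j = 0) (hu' : ∀ k, k ≠ j → u' k ^ d k = 1) :
    ptMap d f g h u 0 = ptMap d f g h u' 0 := by
  apply ptMap_ext
  · intro i
    rw [ptMap_x, ptMap_x]
    by_cases hi : i = j
    · rw [hi, hj, hj']
    · rw [hu i hi, hu' i hi]
  · rw [ptMap_t, ptMap_t]
  · intro i
    rw [ptMap_y, ptMap_y, zero_pow (hg i).ne', mul_zero, mul_zero]
  · rw [ptMap_z, ptMap_z, Finset.prod_eq_zero (Finset.mem_univ j),
      Finset.prod_eq_zero (Finset.mem_univ j)]
    · rw [hj', zero_pow (hh j).ne']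
    · rw [hj, zero_pow (hh j).ne']

theorem lower_bound {K : Type v} [Field K] [IsAlgClosed K] {N : ℕ} (d f g h : Fin N → ℕ)
    (hd : ∀ i, 0 < d i) (hg : ∀ i, 0 < g i) (hh : ∀ i, 0 < h i)
    (hdf : ∀ i, Nat.Coprime (d i) (f i)) (hdh : ∀ i, Nat.Coprime (d i) (h i))
    (hdd : ∀ i j, i ≠ j → Nat.Coprime (d i) (d j))
    (p : ℕ) (hp : p.Prime) (hpK : (p : K) ≠ 0) (i j : Fin N) (hij : i ≠ j) (hpd : p ∣ d i)
    (P : Fin (N + 1) → MvPolynomial (Fin (N + 1) ⊕ Fin (N + 1)) K)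
    (hP : ∀ w, (∀ k, eval w (P k) = 0) ↔ ∃ u t, w = ptMap d f g h u t) : False := by
  obtain ⟨e, he⟩ := hpd
  have he0 : 0 < e := by
    rcases Nat.eq_zero_or_pos e with h0 | h0
    · have := hd i; rw [he, h0] at this; omega
    · exact h0
  let E' : ℕ := ∏ k ∈ (Finset.univ.erase i).erase j, d k
  let E : ℕ := d j * E'
  have hE'0 : 0 < E' := Finset.prod_pos fun k _ => hd k
  have hEk : ∀ k, k ≠ i → k ≠ j → d k ∣ E := fun k h1 h2 =>
    Dvd.dvd.mul_left (Finset.dvd_prod_of_mem d (by simp [h1, h2])) _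
  have hpi : p ∣ d i := ⟨e, he⟩
  have hcop1 : p.Coprime (f i) := Nat.Coprime.coprime_dvd_left hpi (hdf i)
  have hcop2 : p.Coprime (h i * E) := by
    apply Nat.Coprime.coprime_dvd_left hpi
    refine Nat.Coprime.mul_right (hdh i) (Nat.Coprime.mul_right (hdd i j hij) ?_)
    refine Nat.Coprime.prod_right fun k hk => hdd i k ?_
    simp at hk
    exact fun h => hk.2 h.symm
  -- the polynomials
  let σ := Fin (N + 1) ⊕ Fin (N + 1)
  let y' : MvPolynomial σ K := X (Sum.inr i.castSucc) ^ e
  let T' : MvPolynomial σ K := X (Sum.inl (Fin.last N)) ^ (g i * e)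
  let c' : MvPolynomial σ K := X (Sum.inr (Fin.last N)) ^ (E * e)
  let w' : MvPolynomial σ K := X (Sum.inl j.castSucc) ^ (h j * E' * e)
  let b : MvPolynomial σ K := geomQ p y' T'
  let a : MvPolynomial σ K := (p : MvPolynomial σ K) * T' ^ (p - 1) - b
  let b' : MvPolynomial σ K := geomQ p c' w'
  let a' : MvPolynomial σ K := (p : MvPolynomial σ K) * w' ^ (p - 1) - b'
  let F : List (MvPolynomial σ K) := List.ofFn P ++
    (Finset.univ.erase j).toList.map fun k => X (Sum.inl k.castSucc) - 1
  have hN : 0 < N := i.pos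
  have hlen : F.length + 2 = Fintype.card σ := by
    simp [F, σ]
    omega
  have hp1 : p - 1 ≠ 0 := by have := hp.two_le; omega
  have hF : ∀ w, (∀ s ∈ F, eval w s = 0) ↔
      ∃ u t, w = ptMap d f g h u t ∧ ∀ k, k ≠ j → u k ^ d k = 1 := by
    intro w
    have h1 : (∀ s ∈ F, eval w s = 0) ↔ (∀ k, eval w (P k) = 0) ∧
        ∀ k : Fin N, k ≠ j → w (Sum.inl k.castSucc) = 1 := by
      simp only [F, List.forall_mem_append, List.forall_mem_map, Finset.mem_toList,
        Finset.mem_erase, Finset.mem_univ, and_true, map_sub, eval_X, map_one, sub_eq_zero,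
        List.forall_mem_ofFn_iff]
    rw [h1, hP]
    constructor
    · rintro ⟨⟨u, t, rfl⟩, h2⟩
      exact ⟨u, t, rfl, fun k hk => by rw [← h2 k hk, ptMap_x]⟩
    · rintro ⟨u, t, rfl, h2⟩
      exact ⟨⟨u, t, rfl⟩, fun k hk => by rw [ptMap_x, h2 k hk]⟩
  have hsum : ∀ w, eval w (a + b) = p * (w (Sum.inl (Fin.last N)) ^ (g i * e)) ^ (p - 1) := by
    intro w
    have : a + b = (p : MvPolynomial σ K) * T' ^ (p - 1) := by simp only [a]; ring
    rw [this]
    simp [T']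
  have hsum' : ∀ w, eval w (a' + b') = p * (w (Sum.inl j.castSucc) ^ (h j * E' * e)) ^ (p - 1) := by
    intro w
    have : a' + b' = (p : MvPolynomial σ K) * w' ^ (p - 1) := by simp only [a']; ring
    rw [this]
    simp [w']
  have hkey : ∀ u : Fin N → K, ∀ t, (∀ k, k ≠ j → u k ^ d k = 1) →
      (u i ^ e = 1 → eval (ptMap d f g h u t) a = 0 ∧ eval (ptMap d f g h u t) a' = 0) ∧
      (u i ^ e ≠ 1 → eval (ptMap d f g h u t) b = 0 ∧ eval (ptMap d f g h u t) b' = 0) := by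
    intro u t hu
    have hθ : (u i ^ e) ^ p = 1 := by rw [← pow_mul, mul_comm e p, ← he, hu i hij]
    have hy : eval (ptMap d f g h u t) y' = (u i ^ e) ^ f i * t ^ (g i * e) := by
      simp only [y', map_pow, eval_X, ptMap_y]; ring
    have hT : eval (ptMap d f g h u t) T' = t ^ (g i * e) := by
      simp only [T', map_pow, eval_X, ptMap_t]
    have hw : eval (ptMap d f g h u t) w' = u j ^ (h j * E * e) := by
      simp only [w', map_pow, eval_X, ptMap_x, E]; ring
    have hc : eval (ptMap d f g h u t) c' = (u i ^ e) ^ (h i * E) * u j ^ (h j * E * e) := by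
      simp only [c', map_pow, eval_X, ptMap_z]
      rw [← Finset.prod_pow, Finset.prod_eq_mul i j hij]
      · ring
      · intro k _ hk
        obtain ⟨z, hz⟩ := hEk k hk.1 hk.2
        rw [hz]
        calc _ = (u k ^ d k) ^ (h k * z * e) := by ring
          _ = 1 := by rw [hu k hk.2, one_pow]
      · simp
      · simp
    have hb : eval (ptMap d f g h u t) b = geomQ p ((u i ^ e) ^ f i * t ^ (g i * e)) (t ^ (g i * e)) := by
      simp only [b]; rw [geomQ_map, hy, hT]
    have hb' : eval (ptMap d f g h u t) b' = geomQ p ((u i ^ e) ^ (h i * E) * u j ^ (h j * E * e)) (u j ^ (h j * E * e)) := by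
      simp only [b']; rw [geomQ_map, hc, hw]
    constructor
    · intro h1
      rw [h1, one_pow, one_mul, geomQ_one] at hb hb'
      constructor
      · simp only [a]
        rw [map_sub, hb, map_mul, map_pow, hT, map_natCast, sub_self]
      · simp only [a']
        rw [map_sub, hb', map_mul, map_pow, hw, map_natCast, sub_self]
    · intro h1
      rw [hb, hb']
      exact ⟨geomQ_zero p _ _ hθ h1 hp _ hcop1, geomQ_zero p _ _ hθ h1 hp _ hcop2⟩
  let u₁ : Fin N → K := Function.update (fun _ => 1) j 0
  have hu₁j : u₁ j = 0 := by simp [u₁]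
  have hu₁ : ∀ k, k ≠ j → u₁ k ^ d k = 1 := by
    intro k hk; simp [u₁, hk]
  have hne : ∀ τ : K, τ ≠ 0 → ∀ u, eval (ptMap d f g h u τ) (a + b) ≠ 0 := by
    intro τ hτ u
    rw [hsum, ptMap_t]
    exact mul_ne_zero hpK (pow_ne_zero _ (pow_ne_zero _ hτ))
  refine connectedness (ptMap d f g h u₁ 0) F hlen a b a' b' ?_ ?_ ?_ ?_ ?_ ?_
  · intro w hw
    obtain ⟨u, t, rfl, hu⟩ := (hF w).1 hw
    by_cases h1 : u i ^ e = 1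
    · rw [map_mul, ((hkey u t hu).1 h1).1, zero_mul]
    · rw [map_mul, ((hkey u t hu).2 h1).1, mul_zero]
  · intro w hw
    obtain ⟨u, t, rfl, hu⟩ := (hF w).1 hw
    by_cases h1 : u i ^ e = 1
    · rw [map_mul, ((hkey u t hu).1 h1).1, zero_mul]
    · rw [map_mul, ((hkey u t hu).2 h1).2, mul_zero]
  · intro w hw
    obtain ⟨u, t, rfl, hu⟩ := (hF w).1 hw
    by_cases h1 : u i ^ e = 1
    · rw [map_mul, ((hkey u t hu).1 h1).2, zero_mul]
    · rw [map_mul, ((hkey u t hu).2 h1).1, mul_zero]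
  · intro w
    rw [hF, hsum, hsum']
    constructor
    · rintro ⟨⟨u, t, rfl, hu⟩, h1, h2⟩
      rw [ptMap_t] at h1
      rw [ptMap_x] at h2
      have ht : t = 0 := eq_zero_of_pow_eq_zero
        (eq_zero_of_pow_eq_zero ((mul_eq_zero.1 h1).resolve_left hpK))
      have huj : u j = 0 := eq_zero_of_pow_eq_zero (eq_zero_of_pow_eq_zero
        (eq_zero_of_pow_eq_zero ((mul_eq_zero.1 h2).resolve_left hpK)))
      rw [ht]
      exact special_point d f g h hd hg hh j u u₁ huj hu hu₁j hu₁
    · rintro rfl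
      refine ⟨⟨u₁, 0, rfl, hu₁⟩, ?_, ?_⟩
      · rw [ptMap_t, zero_pow (Nat.mul_pos (hg i) he0).ne', zero_pow hp1, mul_zero]
      · rw [ptMap_x, hu₁j, zero_pow (hd j).ne',
          zero_pow (Nat.mul_pos (Nat.mul_pos (hh j) hE'0) he0).ne', zero_pow hp1, mul_zero]
  · intro s hs
    have : NeZero (p : K) := ⟨hpK⟩
    have : NeZero p := ⟨hp.ne_zero⟩
    obtain ⟨θ, hθ⟩ := HasEnoughRootsOfUnity.exists_primitiveRoot K p
    obtain ⟨ζ, hζ⟩ := IsAlgClosed.exists_pow_nat_eq θ he0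
    let u₂ : Fin N → K := Function.update u₁ i ζ
    have hu₂j : u₂ j = 0 := by simp [u₂, hij.symm, hu₁j]
    have hu₂i : u₂ i = ζ := by simp [u₂]
    have hu₂ : ∀ k, k ≠ j → u₂ k ^ d k = 1 := by
      intro k hk
      by_cases hki : k = i
      · rw [hki, hu₂i, he, mul_comm, pow_mul, hζ, hθ.pow_eq_one]
      · simp only [u₂, Function.update_of_ne hki]
        exact hu₁ k hk
    rw [special_point d f g h hd hg hh j u₁ u₂ hu₁j hu₁ hu₂j hu₂]
    apply curve_limit
    intro τ hτ
    refine hs _ ((hF _).2 ⟨u₂, τ, rfl, hu₂⟩) ((hkey u₂ τ hu₂).2 ?_).1 (hne τ hτ _)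
    rw [hu₂i, hζ]
    exact hθ.ne_one hp.one_lt
  · intro s hs
    apply curve_limit
    intro τ hτ
    refine hs _ ((hF _).2 ⟨u₁, τ, rfl, hu₁⟩) ((hkey u₁ τ hu₁).1 ?_).1 (hne τ hτ _)
    simp [u₁, hij]

end LowerPart

section UpperPart

universe v

theorem coprime_root {K : Type v} [Field K] (m k : ℕ) (hm : 0 < m) (hk : 0 < k)
    (hmk : m.Coprime k) (x y : K) (hxy : y ^ m = x ^ k) : ∃ u : K, u ^ m = x ∧ u ^ k = y := by
  by_cases hx : x = 0
  · rw [hx, zero_pow hk.ne'] at hxy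
    have hy := eq_zero_of_pow_eq_zero hxy
    exact ⟨0, by rw [hx, zero_pow hm.ne'], by rw [hy, zero_pow hk.ne']⟩
  · have hy : y ≠ 0 := by
      rintro rfl
      rw [zero_pow hm.ne'] at hxy
      exact hx (eq_zero_of_pow_eq_zero hxy.symm)
    obtain ⟨s, r, hsr⟩ := Nat.isCoprime_iff_coprime.2 hmk
    have hxy' : y ^ (m : ℤ) = x ^ (k : ℤ) := by exact_mod_cast hxy
    refine ⟨x ^ s * y ^ r, ?_, ?_⟩
    · calc (x ^ s * y ^ r) ^ m = x ^ (s * m) * (y ^ (m : ℤ)) ^ r := by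
            rw [mul_pow, ← zpow_natCast, ← zpow_natCast, ← zpow_mul, ← zpow_mul, ← zpow_mul,
              mul_comm r]
        _ = x ^ (s * m + r * k) := by
            rw [hxy', ← zpow_mul, ← zpow_add₀ hx, mul_comm r]
        _ = x := by rw [hsr, zpow_one]
    · calc (x ^ s * y ^ r) ^ k = (x ^ (k : ℤ)) ^ s * y ^ (r * k) := by
            rw [mul_pow, ← zpow_natCast, ← zpow_natCast, ← zpow_mul, ← zpow_mul, ← zpow_mul,
              mul_comm s]
        _ = y ^ (s * m + r * k) := by
            rw [← hxy', ← zpow_mul, ← zpow_add₀ hy, mul_comm s]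
        _ = y := by rw [hsr, zpow_one]

theorem split_root {K : Type v} [Field K] {ι : Type} [DecidableEq ι] (d h : ι → ℕ)
    (hd : ∀ i, 0 < d i) (hh : ∀ i, 0 < h i) (hdh : ∀ i, Nat.Coprime (d i) (h i))
    (hdd : ∀ i j, i ≠ j → Nat.Coprime (d i) (d j)) (s : Finset ι) :
    ∀ ω : K, ω ^ (∏ i ∈ s, d i) = 1 →
      ∃ v : ι → K, (∀ i, v i ^ d i = 1) ∧ ∏ i ∈ s, v i ^ h i = ω := by
  induction s using Finset.induction_on with
  | empty =>
    intro ω hω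
    refine ⟨fun _ => 1, by simp, ?_⟩
    simpa using hω.symm
  | insert a s ha ih =>
    intro ω hω
    rw [Finset.prod_insert ha] at hω
    set D := ∏ i ∈ s, d i with hD
    have hcop : (d a).Coprime D := Nat.Coprime.prod_right fun k hk =>
      hdd a k (by rintro rfl; exact ha hk)
    have hω0 : ω ≠ 0 := by
      rintro rfl
      have : 0 < D := Finset.prod_pos fun i _ => hd i
      rw [zero_pow (Nat.mul_pos (hd a) this).ne'] at hω
      exact zero_ne_one hω
    obtain ⟨p, r, hpr⟩ := Nat.isCoprime_iff_coprime.2 hcop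
    have hω' : ω ^ ((d a : ℤ) * D) = 1 := by exact_mod_cast hω
    obtain ⟨v, hv1, hv2⟩ := ih (ω ^ (p * d a)) (by
      rw [← zpow_natCast, ← zpow_mul, mul_assoc, mul_comm p, zpow_mul, hω', one_zpow])
    obtain ⟨η, hη1, hη2⟩ := coprime_root (d a) (h a) (hd a) (hh a) (hdh a) 1 (ω ^ (r * D)) (by
      rw [← zpow_natCast, ← zpow_mul, one_pow, mul_assoc, mul_comm r, mul_comm (D : ℤ), zpow_mul,
        hω', one_zpow])
    refine ⟨Function.update v a η, ?_, ?_⟩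
    · intro i
      by_cases hi : i = a
      · subst hi; simpa using hη1
      · simpa [hi] using hv1 i
    · rw [Finset.prod_insert ha, Function.update_self, hη2]
      have : ∏ i ∈ s, Function.update v a η i ^ h i = ∏ i ∈ s, v i ^ h i := by
        refine Finset.prod_congr rfl fun i hi => ?_
        rw [Function.update_of_ne (by rintro rfl; exact ha hi)]
      rw [this, hv2, ← zpow_add₀ hω0, add_comm, hpr, zpow_one]

theorem upper_numbers {N : ℕ} (d f h : Fin N → ℕ) (hd : ∀ i, 0 < d i) (hf : ∀ i, 0 < f i)
    (hh : ∀ i, 0 < h i) (hdf : ∀ i, Nat.Coprime (d i) (f i)) :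
    ∃ (k : ℕ) (α β : Fin N → ℕ), (∏ i, d i).Coprime k ∧ 0 < k ∧
      ∀ i, α i * d i + β i * f i = h i * k := by
  let k := 1 + (∏ i, d i) * ∏ i, f i
  have : ∀ i, ∃ a b, a * d i + b * f i = h i * k := by
    intro i
    refine Nat.exists_add_mul_eq_of_gcd_dvd_of_mul_pred_le _ _ _ ?_ ?_
    · rw [(hdf i).gcd_eq_one]; exact one_dvd _
    · have h1 : d i ≤ ∏ i, d i :=
        Nat.le_of_dvd (Finset.prod_pos fun i _ => hd i) (Finset.dvd_prod_of_mem d (Finset.mem_univ i))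
      have h2 : f i ≤ ∏ i, f i :=
        Nat.le_of_dvd (Finset.prod_pos fun i _ => hf i) (Finset.dvd_prod_of_mem f (Finset.mem_univ i))
      calc (d i).pred * (f i).pred ≤ d i * f i := Nat.mul_le_mul (Nat.pred_le _) (Nat.pred_le _)
        _ ≤ (∏ i, d i) * ∏ i, f i := Nat.mul_le_mul h1 h2
        _ ≤ k := by simp [k]
        _ ≤ h i * k := Nat.le_mul_of_pos_left _ (hh i)
  choose α β hαβ using this
  refine ⟨k, α, β, ?_, by simp [k], hαβ⟩
  simp [k]

theorem upper_bound {K : Type v} [Field K] [IsAlgClosed K] {N : ℕ} (d f g h : Fin N → ℕ)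
    (hd : ∀ i, 0 < d i) (hf : ∀ i, 0 < f i) (hg : ∀ i, 0 < g i) (hh : ∀ i, 0 < h i)
    (hdf : ∀ i, Nat.Coprime (d i) (f i)) (hdh : ∀ i, Nat.Coprime (d i) (h i))
    (hdd : ∀ i j, i ≠ j → Nat.Coprime (d i) (d j)) :
    ∃ P : Fin (N + 1 + 1) → MvPolynomial (Fin (N + 1) ⊕ Fin (N + 1)) K,
      ∀ w, (∀ k, eval w (P k) = 0) ↔ ∃ u t, w = ptMap d f g h u t := by
  obtain ⟨k, α, β, hcop, hk, hαβ⟩ := upper_numbers d f h hd hf hh hdf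
  set D := ∏ i, d i with hD
  have hD0 : 0 < D := Finset.prod_pos fun i _ => hd i
  let D' : Fin N → ℕ := fun i => ∏ k ∈ Finset.univ.erase i, d k
  have hDD : ∀ i, d i * D' i = D := fun i => Finset.mul_prod_erase _ d (Finset.mem_univ i)
  let σ := Fin (N + 1) ⊕ Fin (N + 1)
  let x : Fin N → MvPolynomial σ K := fun i => X (Sum.inl i.castSucc)
  let t : MvPolynomial σ K := X (Sum.inl (Fin.last N))
  let y : Fin N → MvPolynomial σ K := fun i => X (Sum.inr i.castSucc)
  let z : MvPolynomial σ K := X (Sum.inr (Fin.last N))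
  let P1 : Fin N → MvPolynomial σ K := fun i => y i ^ d i - x i ^ f i * t ^ (g i * d i)
  let P2 : MvPolynomial σ K := z ^ D - ∏ i, x i ^ (h i * D' i)
  let P3 : MvPolynomial σ K := t ^ (∑ i, β i * g i) * z ^ k - ∏ i, x i ^ α i * y i ^ β i
  let P12 : Fin (N + 1) → MvPolynomial σ K := Fin.snoc P1 P2
  let P : Fin (N + 1 + 1) → MvPolynomial σ K := Fin.snoc P12 P3
  refine ⟨P, fun w => ?_⟩
  have h1 : (∀ k, eval w (P k) = 0) ↔
      (∀ i, eval w (P1 i) = 0) ∧ eval w P2 = 0 ∧ eval w P3 = 0 := by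
    rw [Fin.forall_fin_succ', Fin.forall_fin_succ']
    simp [P, P12, and_assoc]
  rw [h1]
  simp only [P1, P2, P3, x, y, z, t, map_sub, map_mul, map_pow, map_prod, eval_X, sub_eq_zero]
  constructor
  · rintro ⟨e1, e2, e3⟩
    -- comparison of last coordinates
    have hcmp : ∀ u : Fin N → K, (∀ i, u i ^ d i = w (Sum.inl i.castSucc)) →
        w (Sum.inr (Fin.last N)) ^ D = (∏ i, u i ^ h i) ^ D := by
      intro u hu
      rw [e2, ← Finset.prod_pow]
      refine Finset.prod_congr rfl fun i _ => ?_
      rw [← hu i, ← hDD i]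
      ring
    by_cases ht : w (Sum.inl (Fin.last N)) = 0
    · have hy : ∀ i : Fin N, w (Sum.inr i.castSucc) = 0 := by
        intro i
        have := e1 i
        rw [ht, zero_pow (Nat.mul_pos (hg i) (hd i)).ne', mul_zero] at this
        exact eq_zero_of_pow_eq_zero this
      have hroot : ∀ i : Fin N, ∃ u : K, u ^ d i = w (Sum.inl i.castSucc) := fun i =>
        IsAlgClosed.exists_pow_nat_eq _ (hd i)
      choose u hu using hroot
      have h2 := hcmp u hu
      suffices ∃ v : Fin N → K, (∀ i, v i ^ d i = w (Sum.inl i.castSucc)) ∧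
          ∏ i, v i ^ h i = w (Sum.inr (Fin.last N)) by
        obtain ⟨v, hv1, hv2⟩ := this
        refine ⟨v, 0, ptMap_ext _ _ ?_ ?_ ?_ ?_⟩
        · intro i; rw [ptMap_x, hv1]
        · rw [ptMap_t, ht]
        · intro i; rw [ptMap_y, hy i, zero_pow (hg i).ne', mul_zero]
        · rw [ptMap_z, hv2]
      by_cases hY : ∏ i, u i ^ h i = 0
      · rw [hY, zero_pow hD0.ne'] at h2
        exact ⟨u, hu, by rw [hY, eq_zero_of_pow_eq_zero h2]⟩
      · obtain ⟨v, hv1, hv2⟩ := split_root d h hd hh hdh hdd Finset.univ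
          (w (Sum.inr (Fin.last N)) / ∏ i, u i ^ h i)
          (by rw [← hD, div_pow, h2, div_self (pow_ne_zero _ hY)])
        refine ⟨fun i => u i * v i, ?_, ?_⟩
        · intro i; rw [mul_pow, hu, hv1, mul_one]
        · simp only [mul_pow]
          rw [Finset.prod_mul_distrib, hv2, mul_div_cancel₀ _ hY]
    · have hroot : ∀ i : Fin N, ∃ u : K, u ^ d i = w (Sum.inl i.castSucc) ∧
          u ^ f i = w (Sum.inr i.castSucc) / w (Sum.inl (Fin.last N)) ^ g i := by
        intro i
        apply coprime_root _ _ (hd i) (hf i) (hdf i)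
        rw [div_pow, e1 i, ← pow_mul, mul_div_assoc, div_self (pow_ne_zero _ ht), mul_one]
      choose u hu1 hu2 using hroot
      have hu3 : ∀ i : Fin N, w (Sum.inr i.castSucc) =
          u i ^ f i * w (Sum.inl (Fin.last N)) ^ g i := by
        intro i; rw [hu2, div_mul_cancel₀ _ (pow_ne_zero _ ht)]
      refine ⟨u, w (Sum.inl (Fin.last N)), ptMap_ext _ _ ?_ ?_ ?_ ?_⟩
      · intro i; rw [ptMap_x, hu1]
      · rw [ptMap_t]
      · intro i; rw [ptMap_y, hu3]
      · rw [ptMap_z]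
        have h2 := hcmp u hu1
        have h3 : w (Sum.inr (Fin.last N)) ^ k = (∏ i, u i ^ h i) ^ k := by
          have h4 : ∏ i : Fin N, w (Sum.inl i.castSucc) ^ α i * w (Sum.inr i.castSucc) ^ β i =
              w (Sum.inl (Fin.last N)) ^ (∑ i, β i * g i) * (∏ i, u i ^ h i) ^ k := by
            rw [← Finset.prod_pow, ← Finset.prod_pow_eq_pow_sum, ← Finset.prod_mul_distrib]
            refine Finset.prod_congr rfl fun i _ => ?_
            rw [hu3, ← hu1, ← pow_mul (u i) (h i) k, ← hαβ i]
            ring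
          rw [h4] at e3
          exact mul_left_cancel₀ (pow_ne_zero _ ht) e3
        by_cases hY : ∏ i, u i ^ h i = 0
        · rw [hY, zero_pow hD0.ne'] at h2
          rw [hY, eq_zero_of_pow_eq_zero h2]
        · rw [← div_eq_one_iff_eq hY, ← orderOf_eq_one_iff, ← Nat.dvd_one]
          refine dvd_trans (Nat.dvd_gcd ?_ ?_) (dvd_of_eq hcop.gcd_eq_one)
          · apply orderOf_dvd_of_pow_eq_one
            rw [div_pow, h2, div_self (pow_ne_zero _ hY)]
          · apply orderOf_dvd_of_pow_eq_one
            rw [div_pow, h3, div_self (pow_ne_zero _ hY)]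
  · rintro ⟨u, t, rfl⟩
    simp only [ptMap_x, ptMap_y, ptMap_z, ptMap_t]
    refine ⟨fun i => by ring, ?_, ?_⟩
    · rw [← Finset.prod_pow]
      refine Finset.prod_congr rfl fun i _ => ?_
      rw [← hDD i]; ring
    · rw [← Finset.prod_pow, ← Finset.prod_pow_eq_pow_sum, ← Finset.prod_mul_distrib]
      refine Finset.prod_congr rfl fun i _ => ?_
      rw [← pow_mul (u i) (h i) k, ← hαβ i]
      ring

end UpperPart

theorem range_phiMap {K : Type*} [Field K] (N : ℕ) (d f g h : Fin N → ℕ)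
    (w : Fin (N + 1) ⊕ Fin (N + 1) → K) :
    w ∈ Set.range (phiMap (N + 1) d f g h) ↔ ∃ u t, w = ptMap d f g h u t := by
  have key : ∀ v : Fin (N + 1) → K,
      phiMap (N + 1) d f g h v = ptMap d f g h (fun i => v i.castSucc) (v (Fin.last N)) := by
    intro v
    apply ptMap_ext
    · intro i; rw [ptMap_x]; simp [phiMap]
    · rw [ptMap_t]; simp [phiMap]
    · intro i; rw [ptMap_y]; simp [phiMap]; exact Or.inl rfl
    · rw [ptMap_z]; simp [phiMap]; rfl
  constructor
  · rintro ⟨v, rfl⟩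
    exact ⟨_, _, key v⟩
  · rintro ⟨u, t, rfl⟩
    refine ⟨(Fin.snoc u t : Fin (N + 1) → K), ?_⟩
    rw [key]
    simp

/-- The arithmetical rank of `V` is exactly `n + 1`: `V` is the common zero set
of `n + 1` polynomials in `K[x_1,…,x_n,y_1,…,y_n]`, but not of `n` polynomials. -/
theorem toric_ara_eq_n_add_one
    (K : Type*) [Field K] [IsAlgClosed K]
    (n : ℕ) (hn : 3 ≤ n)
    (d f g h : Fin (n - 1) → ℕ)
    (hd : ∀ i, 0 < d i) (hf : ∀ i, 0 < f i) (hg : ∀ i, 0 < g i) (hh : ∀ i, 0 < h i)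
    (hdf : ∀ i, Nat.Coprime (d i) (f i))
    (hdh : ∀ i, Nat.Coprime (d i) (h i))
    (hdd : ∀ i j, i ≠ j → Nat.Coprime (d i) (d j))
    (p q : ℕ) (hp : p.Prime) (hq : q.Prime) (hpq : p ≠ q)
    (i₀ j₀ : Fin (n - 1)) (hpd : p ∣ d i₀) (hqd : q ∣ d j₀) :
    (∃ P : Fin (n + 1) → MvPolynomial (Fin n ⊕ Fin n) K,
      {w : Fin n ⊕ Fin n → K | ∀ k, MvPolynomial.eval w (P k) = 0}
        = Set.range (phiMap n d f g h)) ∧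
    ¬ ∃ P : Fin n → MvPolynomial (Fin n ⊕ Fin n) K,
      {w : Fin n ⊕ Fin n → K | ∀ k, MvPolynomial.eval w (P k) = 0}
        = Set.range (phiMap n d f g h) := by
  obtain ⟨N, rfl⟩ : ∃ N, n = N + 1 := ⟨n - 1, by omega⟩
  constructor
  · obtain ⟨P, hP⟩ := upper_bound (K := K) (N := N) d f g h hd hf hg hh hdf hdh hdd
    refine ⟨P, ?_⟩
    ext w
    rw [Set.mem_ofPred_eq, hP, range_phiMap]
  · rintro ⟨P, hP⟩
    have hP' : ∀ w, (∀ k, eval w (P k) = 0) ↔ ∃ u t, w = ptMap (N := N) d f g h u t := by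
      intro w
      rw [← range_phiMap, ← hP, Set.mem_ofPred_eq]
    have hj : ∀ i : Fin N, ∃ j : Fin N, i ≠ j := by
      intro i
      have : Nontrivial (Fin N) := Fin.nontrivial_iff_two_le.2 (by omega)
      obtain ⟨j, hj⟩ := exists_ne i
      exact ⟨j, hj.symm⟩
    by_cases hpK : (p : K) = 0
    · have hqK : (q : K) ≠ 0 := by
        intro hqK
        have hc := (Nat.isCoprime_iff_coprime.2 ((Nat.coprime_primes hp hq).2 hpq))
        obtain ⟨s, r, hsr⟩ := hc
        have h1 : ((s * p + r * q : ℤ) : K) = 1 := by rw [hsr]; simp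
        push_cast at h1
        rw [hpK, hqK, mul_zero, mul_zero, add_zero] at h1
        exact zero_ne_one h1
      obtain ⟨j, hij⟩ := hj j₀
      exact lower_bound (N := N) d f g h hd hg hh hdf hdh hdd q hq hqK j₀ j hij hqd P hP'
    · obtain ⟨j, hij⟩ := hj i₀
      exact lower_bound (N := N) d f g h hd hg hh hdf hdh hdd p hp hpK i₀ j hij hpd P hP'
end

section
/- There exist n+1 binomials in K[x_1,…,x_n,y_1,…,y_n] whose common zero set in K^{2n} is exactly V; in particular the arithmetical rank of V is at most n+1. -/
open MvPolynomial

theorem aux_root {K : Type*} [Field K] (x v : K) (d f : ℕ) (hd : 0 < d) (hf : 0 < f)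
    (hc : Nat.Coprime d f) (e : v ^ d = x ^ f) : ∃ u : K, u ^ d = x ∧ u ^ f = v := by
  by_cases hx : x = 0
  · subst hx
    rw [zero_pow hf.ne'] at e
    have hv : v = 0 := by simpa [hd.ne'] using e
    exact ⟨0, by simp [hd.ne'], by simp [hf.ne', hv]⟩
  · have hv : v ≠ 0 := by
      rintro rfl
      rw [zero_pow hd.ne'] at e
      exact pow_ne_zero _ hx e.symm
    obtain ⟨a, b, hab⟩ := (Nat.isCoprime_iff_coprime.mpr hc)
    have e' : v ^ (d : ℤ) = x ^ (f : ℤ) := by exact_mod_cast e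
    refine ⟨x ^ a * v ^ b, ?_, ?_⟩
    · rw [← zpow_natCast, mul_zpow, ← zpow_mul, ← zpow_mul, mul_comm b, zpow_mul v, e',
        ← zpow_mul, ← zpow_add₀ hx, mul_comm (f : ℤ), hab, zpow_one]
    · rw [← zpow_natCast, mul_zpow, ← zpow_mul, ← zpow_mul, mul_comm a, zpow_mul x, ← e',
        ← zpow_mul, ← zpow_add₀ hv, mul_comm (d : ℤ), hab, zpow_one]

theorem aux_bezout (d f : ℕ) (hd : 0 < d) (hf : 0 < f) (hc : Nat.Coprime d f) :
    ∃ α β : ℕ, d * α = 1 + f * β := by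
  obtain ⟨a, b, hab⟩ := (Nat.isCoprime_iff_coprime.mpr hc)
  have hd' : (1 : ℤ) ≤ d := by exact_mod_cast hd
  have hf' : (1 : ℤ) ≤ f := by exact_mod_cast hf
  have h1 : 0 ≤ a + (|a| + |b|) * f := by
    nlinarith [neg_abs_le a, abs_nonneg a, abs_nonneg b]
  have h2 : 0 ≤ -b + (|a| + |b|) * d := by
    nlinarith [le_abs_self b, abs_nonneg a, abs_nonneg b]
  obtain ⟨α, hα⟩ := Int.eq_ofNat_of_zero_le h1
  obtain ⟨β, hβ⟩ := Int.eq_ofNat_of_zero_le h2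
  refine ⟨α, β, ?_⟩
  zify
  rw [← hα, ← hβ]
  linear_combination hab

theorem aux_unity {K : Type*} [Field K] {m : ℕ} (d h : Fin m → ℕ)
    (hdh : ∀ i, Nat.Coprime (d i) (h i))
    (hdd : ∀ i j, i ≠ j → Nat.Coprime (d i) (d j)) (hm : 0 < m) (ζ : K) (hζ : ζ ≠ 0)
    (e : ζ ^ (∏ i, d i) = 1) :
    ∃ ε : Fin m → K, (∀ i, ε i ^ d i = 1) ∧ ∏ i, ε i ^ h i = ζ := by
  haveI : Nonempty (Fin m) := ⟨⟨0, hm⟩⟩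
  obtain ⟨c, hc⟩ := (exists_sum_eq_one_iff_pairwise_coprime' (R := ℤ)
    (s := fun i : Fin m => (d i : ℤ))).mpr
    (fun i j hij => Nat.isCoprime_iff_coprime.mpr (hdd i j hij))
  have hab : ∀ i, ∃ a b : ℤ, a * d i + b * h i = 1 := fun i =>
    Nat.isCoprime_iff_coprime.mpr (hdh i)
  choose a b hab using hab
  have e' : ζ ^ (∏ i, (d i : ℤ)) = 1 := by
    rw [← Nat.cast_prod, zpow_natCast, e]
  have hP : ∀ i, (∏ j ∈ {i}ᶜ, (d j : ℤ)) * d i = ∏ j, (d j : ℤ) := fun i => by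
    rw [mul_comm]; exact (Fintype.prod_eq_mul_prod_compl i (fun j => (d j : ℤ))).symm
  refine ⟨fun i => ζ ^ (c i * (∏ j ∈ {i}ᶜ, (d j : ℤ)) * b i), fun i => ?_, ?_⟩
  · rw [← zpow_natCast, ← zpow_mul]
    have : c i * (∏ j ∈ {i}ᶜ, (d j : ℤ)) * b i * d i = (∏ j, (d j : ℤ)) * (c i * b i) := by
      rw [← hP i]; ring
    rw [this, zpow_mul, e', one_zpow]
  · have key : ∀ i, (ζ ^ (c i * (∏ j ∈ {i}ᶜ, (d j : ℤ)) * b i)) ^ h i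
        = ζ ^ (c i * ∏ j ∈ {i}ᶜ, (d j : ℤ)) := fun i => by
      rw [← zpow_natCast, ← zpow_mul]
      have : c i * (∏ j ∈ {i}ᶜ, (d j : ℤ)) * b i * h i =
          c i * (∏ j ∈ {i}ᶜ, (d j : ℤ)) + (∏ j, (d j : ℤ)) * (-(c i * a i)) := by
        rw [← hP i]; linear_combination (c i * (∏ j ∈ {i}ᶜ, (d j : ℤ))) * hab i
      rw [this, zpow_add₀ hζ, zpow_mul ζ (∏ j, (d j : ℤ)), e', one_zpow, mul_one]
    have hz : ∀ s : Finset (Fin m), ∀ t : Fin m → ℤ, ∏ i ∈ s, ζ ^ t i = ζ ^ ∑ i ∈ s, t i := by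
      intro s t
      induction s using Finset.cons_induction with
      | empty => simp
      | cons i s hi ih => rw [Finset.prod_cons, Finset.sum_cons, zpow_add₀ hζ, ih]
    simp only [key]
    rw [hz, hc, zpow_one]

theorem aux_prod {K : Type*} [Field K] [IsAlgClosed K] {m : ℕ} (d h : Fin m → ℕ)
    (hd : ∀ i, 0 < d i) (hh : ∀ i, 0 < h i)
    (hdh : ∀ i, Nat.Coprime (d i) (h i))
    (hdd : ∀ i j, i ≠ j → Nat.Coprime (d i) (d j)) (hm : 0 < m) (x : Fin m → K) (w : K)
    (e : w ^ (∏ i, d i) = ∏ i, x i ^ (h i * ∏ j ∈ {i}ᶜ, d j)) :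
    ∃ u : Fin m → K, (∀ i, u i ^ d i = x i) ∧ ∏ i, u i ^ h i = w := by
  have hu : ∀ i, ∃ u : K, u ^ d i = x i := fun i => IsAlgClosed.exists_pow_nat_eq _ (hd i)
  choose u hu using hu
  have e2 : w ^ (∏ i, d i) = (∏ i, u i ^ h i) ^ (∏ i, d i) := by
    rw [e, ← Finset.prod_pow]
    refine Finset.prod_congr rfl fun i _ => ?_
    rw [← hu i, ← pow_mul, ← pow_mul, Fintype.prod_eq_mul_prod_compl i]
    congr 1; ring
  have hD : (∏ i, d i) ≠ 0 := Finset.prod_ne_zero_iff.mpr fun i _ => (hd i).ne'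
  by_cases h0 : ∏ i, u i ^ h i = 0
  · refine ⟨u, hu, ?_⟩
    rw [h0, zero_pow hD] at e2
    rw [h0]; exact (pow_eq_zero_iff hD |>.mp e2).symm
  · have hw : w ≠ 0 := by
      rintro rfl
      rw [zero_pow hD] at e2
      exact pow_ne_zero _ h0 e2.symm
    obtain ⟨ε, h1, h2⟩ := aux_unity d h hdh hdd hm (w / ∏ i, u i ^ h i) (div_ne_zero hw h0)
      (by rw [div_pow, e2, div_self (pow_ne_zero _ h0)])
    refine ⟨fun i => ε i * u i, fun i => by rw [mul_pow, h1, one_mul, hu], ?_⟩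
    simp only [mul_pow, Finset.prod_mul_distrib, h2]
    field_simp

/-- exponent vector -/
noncomputable def auxExp {m : ℕ} (a : Fin m → ℕ) (b : ℕ) (a' : Fin m → ℕ) (b' : ℕ) :
    (Fin (m + 1) ⊕ Fin (m + 1)) →₀ ℕ :=
  Finsupp.equivFunOnFinite.symm
    (Sum.elim (Fin.snoc (α := fun _ => ℕ) a b) (Fin.snoc (α := fun _ => ℕ) a' b'))

theorem aux_eval {K : Type*} [Field K] {m : ℕ} (a : Fin m → ℕ) (b : ℕ) (a' : Fin m → ℕ) (b' : ℕ)
    (p : Fin (m + 1) ⊕ Fin (m + 1) → K) :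
    MvPolynomial.eval p (MvPolynomial.monomial (auxExp a b a' b') (1 : K)) =
      ((∏ i, p (Sum.inl (Fin.castSucc i)) ^ a i) * p (Sum.inl (Fin.last m)) ^ b) *
      ((∏ i, p (Sum.inr (Fin.castSucc i)) ^ a' i) * p (Sum.inr (Fin.last m)) ^ b') := by
  rw [MvPolynomial.eval_monomial, Finsupp.prod_fintype _ _ (fun _ => pow_zero _),
    Fintype.prod_sum_type, Fin.prod_univ_castSucc, Fin.prod_univ_castSucc]
  simp [auxExp]

theorem aux_core {K : Type*} [Field K] [IsAlgClosed K] {m : ℕ} (hm : 0 < m) (d f g h : Fin m → ℕ)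
    (hd : ∀ i, 0 < d i) (hf : ∀ i, 0 < f i) (hg : ∀ i, 0 < g i) (hh : ∀ i, 0 < h i)
    (hdf : ∀ i, Nat.Coprime (d i) (f i))
    (hdh : ∀ i, Nat.Coprime (d i) (h i))
    (hdd : ∀ i j, i ≠ j → Nat.Coprime (d i) (d j))
    (α β : Fin m → ℕ) (hαβ : ∀ i, d i * α i = 1 + f i * β i)
    (x y : Fin m → K) (z w : K) :
    ((∀ i, y i ^ d i = x i ^ f i * z ^ (d i * g i)) ∧
      (w ^ (∏ i, d i) = ∏ i, x i ^ (h i * ∏ j ∈ {i}ᶜ, d j)) ∧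
      ((∏ i, y i ^ (β i * h i)) * w =
        (∏ i, x i ^ (α i * h i)) * z ^ (∑ i, g i * β i * h i))) ↔
    ∃ u : Fin m → K, (∀ i, u i ^ d i = x i) ∧ (∀ i, u i ^ f i * z ^ g i = y i) ∧
      ∏ i, u i ^ h i = w := by
  have fwd : ∀ u : Fin m → K, (∀ i, u i ^ d i = x i) → (∀ i, u i ^ f i * z ^ g i = y i) →
      ((∏ i, y i ^ (β i * h i)) * ∏ i, u i ^ h i =
        (∏ i, x i ^ (α i * h i)) * z ^ (∑ i, g i * β i * h i)) := by
    intro u hx hy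
    rw [← Finset.prod_pow_eq_pow_sum, ← Finset.prod_mul_distrib, ← Finset.prod_mul_distrib]
    refine Finset.prod_congr rfl fun i _ => ?_
    rw [← hx i, ← hy i, ← pow_mul, ← mul_assoc (d i), hαβ i]
    ring
  constructor
  · rintro ⟨hF, hG, hM⟩
    by_cases hz : z = 0
    · subst hz
      obtain ⟨u, h1, h2⟩ := aux_prod d h hd hh hdh hdd hm x w hG
      refine ⟨u, h1, fun i => ?_, h2⟩
      have := hF i
      rw [zero_pow (Nat.mul_pos (hd i) (hg i)).ne', mul_zero] at this
      rw [zero_pow (hg i).ne', mul_zero, (pow_eq_zero_iff (hd i).ne').mp this]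
    · have hu : ∀ i, ∃ u : K, u ^ d i = x i ∧ u ^ f i = y i / z ^ g i := fun i => by
        refine aux_root _ _ _ _ (hd i) (hf i) (hdf i) ?_
        rw [div_pow, hF i, ← pow_mul, mul_comm (g i), mul_div_assoc,
          div_self (pow_ne_zero _ hz), mul_one]
      choose u hx hy using hu
      have hy' : ∀ i, u i ^ f i * z ^ g i = y i := fun i => by
        rw [hy i, div_mul_cancel₀ _ (pow_ne_zero _ hz)]
      refine ⟨u, hx, hy', ?_⟩
      by_cases h0 : ∃ i, u i = 0
      · obtain ⟨i, hi⟩ := h0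
        have hxi : x i = 0 := by rw [← hx i, hi, zero_pow (hd i).ne']
        have hP : h i * ∏ j ∈ {i}ᶜ, d j ≠ 0 :=
          mul_ne_zero (hh i).ne' (Finset.prod_ne_zero_iff.mpr fun j _ => (hd j).ne')
        have hX : ∏ i, x i ^ (h i * ∏ j ∈ {i}ᶜ, d j) = 0 :=
          Finset.prod_eq_zero (Finset.mem_univ i) (by rw [hxi, zero_pow hP])
        rw [hX] at hG
        rw [Finset.prod_eq_zero (Finset.mem_univ i) (by rw [hi, zero_pow (hh i).ne'])]
        exact (eq_zero_of_pow_eq_zero hG).symm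
      · push Not at h0
        have hne : ∏ i, y i ^ (β i * h i) ≠ 0 := Finset.prod_ne_zero_iff.mpr fun i _ => by
          rw [← hy' i]
          exact pow_ne_zero _ (mul_ne_zero (pow_ne_zero _ (h0 i)) (pow_ne_zero _ hz))
        exact mul_left_cancel₀ hne ((fwd u hx hy').trans hM.symm)
  · rintro ⟨u, hx, hy, rfl⟩
    refine ⟨fun i => ?_, ?_, fwd u hx hy⟩
    · rw [← hx i, ← hy i]; ring
    · rw [← Finset.prod_pow]
      refine Finset.prod_congr rfl fun i _ => ?_
      rw [← hx i, ← pow_mul, ← pow_mul, Fintype.prod_eq_mul_prod_compl i]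
      congr 1; ring

/-- There exist `n + 1` binomials (differences of two monomials) whose common
zero set in `K^{2n}` is exactly `V`; in particular `ara V ≤ n + 1`. -/
theorem toric_ara_le_n_add_one_binomials
    (K : Type*) [Field K] [IsAlgClosed K]
    (n : ℕ) (hn : 3 ≤ n)
    (d f g h : Fin (n - 1) → ℕ)
    (hd : ∀ i, 0 < d i) (hf : ∀ i, 0 < f i) (hg : ∀ i, 0 < g i) (hh : ∀ i, 0 < h i)
    (hdf : ∀ i, Nat.Coprime (d i) (f i))
    (hdh : ∀ i, Nat.Coprime (d i) (h i))
    (hdd : ∀ i j, i ≠ j → Nat.Coprime (d i) (d j)) :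
    ∃ B : Fin (n + 1) → MvPolynomial (Fin n ⊕ Fin n) K,
      (∀ k, ∃ s t : (Fin n ⊕ Fin n) →₀ ℕ,
        B k = MvPolynomial.monomial s (1 : K) - MvPolynomial.monomial t (1 : K)) ∧
      {w : Fin n ⊕ Fin n → K | ∀ k, MvPolynomial.eval w (B k) = 0}
        = Set.range (phiMap n d f g h) := by
  obtain ⟨m, rfl⟩ : ∃ m, n = m + 1 := ⟨n - 1, by omega⟩
  change Fin m → ℕ at d f g h
  change ∀ i : Fin m, _ at hd hf hg hh hdf hdh
  change ∀ i j : Fin m, _ at hdd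
  have hm : 0 < m := by omega
  choose α β hαβ using fun i : Fin m => aux_bezout (d i) (f i) (hd i) (hf i) (hdf i)
  let F : Fin m → MvPolynomial (Fin (m + 1) ⊕ Fin (m + 1)) K := fun i =>
    MvPolynomial.monomial (auxExp 0 0 (Pi.single i (d i)) 0) (1 : K) -
      MvPolynomial.monomial (auxExp (Pi.single i (f i)) (d i * g i) 0 0) (1 : K)
  let G : MvPolynomial (Fin (m + 1) ⊕ Fin (m + 1)) K :=
    MvPolynomial.monomial (auxExp (0 : Fin m → ℕ) 0 0 (∏ i, d i)) (1 : K) -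
      MvPolynomial.monomial (auxExp (fun i => h i * ∏ j ∈ {i}ᶜ, d j) 0 0 0) (1 : K)
  let M : MvPolynomial (Fin (m + 1) ⊕ Fin (m + 1)) K :=
    MvPolynomial.monomial (auxExp (0 : Fin m → ℕ) 0 (fun i => β i * h i) 1) (1 : K) -
      MvPolynomial.monomial
        (auxExp (fun i => α i * h i) (∑ i, g i * β i * h i) 0 0) (1 : K)
  refine ⟨Fin.snoc (α := fun _ => MvPolynomial (Fin (m + 1) ⊕ Fin (m + 1)) K)
    (Fin.snoc (α := fun _ => MvPolynomial (Fin (m + 1) ⊕ Fin (m + 1)) K) F G) M, ?_, ?_⟩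
  · intro k
    refine Fin.lastCases ?_ (fun k => ?_) k
    · rw [Fin.snoc_last]; exact ⟨_, _, rfl⟩
    · rw [Fin.snoc_castSucc]
      refine Fin.lastCases ?_ (fun k => ?_) k
      · rw [Fin.snoc_last]; exact ⟨_, _, rfl⟩
      · rw [Fin.snoc_castSucc]; exact ⟨_, _, rfl⟩
  · ext p
    have hc := aux_core hm d f g h hd hf hg hh hdf hdh hdd α β hαβ
      (fun i => p (Sum.inl i.castSucc)) (fun i => p (Sum.inr i.castSucc))
      (p (Sum.inl (Fin.last m))) (p (Sum.inr (Fin.last m)))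
    rw [Set.mem_ofPred_eq, Fin.forall_fin_succ']
    simp only [Fin.snoc_last, Fin.snoc_castSucc]
    rw [Fin.forall_fin_succ']
    simp only [Fin.snoc_last, Fin.snoc_castSucc]
    have hF : ∀ i, MvPolynomial.eval p (F i) = 0 ↔ p (Sum.inr i.castSucc) ^ d i =
        p (Sum.inl i.castSucc) ^ f i * p (Sum.inl (Fin.last m)) ^ (d i * g i) := fun i => by
      simp only [F, map_sub, aux_eval, sub_eq_zero]
      simp [Pi.single_apply, pow_ite, Finset.prod_ite_eq]
    simp only [hF]
    simp only [G, M, map_sub, aux_eval, sub_eq_zero]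
    simp only [Pi.zero_apply, pow_zero, Finset.prod_const_one, one_mul, mul_one, pow_one]
    rw [and_assoc]
    refine hc.trans ?_
    constructor
    · rintro ⟨u, hx, hy, hw⟩
      refine ⟨Fin.snoc (α := fun _ => K) u (p (Sum.inl (Fin.last m))), ?_⟩
      funext q
      rcases q with q | q
      · refine Fin.lastCases ?_ (fun i => ?_) q
        · simp [phiMap]
        · have := hx i
          simpa [phiMap] using this
      · refine Fin.lastCases ?_ (fun i => ?_) q
        · rw [← hw]
          simp only [phiMap, Sum.elim_inr, Fin.val_last, Nat.add_sub_cancel, lt_irrefl, dite_false]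
          refine Finset.prod_congr rfl fun j _ => ?_
          exact congrArg (· ^ h j) (Fin.snoc_castSucc (α := fun _ => K) _ u j)
        · rw [← hy i]
          simp only [phiMap, Sum.elim_inr, Fin.val_castSucc, Nat.add_sub_cancel, i.isLt, dite_true]
          rw [Fin.snoc_castSucc (α := fun _ => K)]
          congr 2
          exact Fin.snoc_last (α := fun _ => K) _ _
    · rintro ⟨u, rfl⟩
      refine ⟨fun i => u i.castSucc, fun i => ?_, fun i => ?_, ?_⟩
      · simp [phiMap]
      · simp [phiMap]
        left
        rfl
      · simp [phiMap]
        rfl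
end

section
/- There do not exist n polynomials G_1,…,G_n ∈ K[x_1,…,x_n,y_1,…,y_n] whose common zero set in K^{2n} is exactly V; in particular the arithmetical rank of V is at least n+1. -/
open MvPolynomial

namespace ToricAux

/-- `wreg I L`: the list `L` is a weakly regular sequence on `A / I`. -/
def wreg {A : Type*} [CommRing A] : Ideal A → List A → Prop
  | _, [] => True
  | I, r :: L => (∀ t, r * t ∈ I → t ∈ I) ∧ wreg (I ⊔ Ideal.span {r}) L

section local_part

variable {A : Type*} [CommRing A]

lemma wreg_append (I : Ideal A) (L M : List A) :
    wreg I (L ++ M) ↔ wreg I L ∧ wreg (I ⊔ Ideal.ofList L) M := by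
  induction L generalizing I with
  | nil => simp [wreg]
  | cons r L ih =>
    simp only [List.cons_append, wreg, ih, Ideal.ofList_cons, sup_assoc, and_assoc]

variable [IsLocalRing A] [IsNoetherianRing A]

lemma wreg_swap (I : Ideal A) (r s : A) (L : List A) (hr : r ∈ IsLocalRing.maximalIdeal A)
    (h : wreg I (r :: s :: L)) : wreg I (s :: r :: L) := by
  obtain ⟨h1, h2, h3⟩ := h
  have key : ∀ t, s * t ∈ I → t ∈ I := by
    let N : Ideal A :=
      { carrier := {t | s * t ∈ I}
        add_mem' := by
          intro a b ha hb
          simp only [Set.mem_ofPred_eq, mul_add] at *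
          exact I.add_mem ha hb
        zero_mem' := by simp
        smul_mem' := by
          intro c x hx
          simp only [Set.mem_ofPred_eq, smul_eq_mul] at *
          have := I.mul_mem_left c hx
          convert this using 1; ring }
    have hN : N ≤ I := by
      refine Submodule.le_of_le_smul_of_le_jacobson_bot (I := Ideal.span {r})
        (IsNoetherian.noetherian N) ?_ ?_
      · rw [IsLocalRing.jacobson_eq_maximalIdeal _ bot_ne_top, Ideal.span_singleton_le_iff_mem]
        exact hr
      · intro t ht
        have ht' : s * t ∈ I := ht
        have := h2 t ((le_sup_left : I ≤ I ⊔ Ideal.span {r}) ht')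
        obtain ⟨i, hi, w, hw, rfl⟩ := Submodule.mem_sup.1 this
        obtain ⟨t', rfl⟩ := Ideal.mem_span_singleton'.1 hw
        refine Submodule.add_mem_sup hi ?_
        rw [mul_comm]
        refine Submodule.smul_mem_smul (Ideal.mem_span_singleton_self r) ?_
        refine h1 _ ?_
        have h4 : s * (i + t' * r) - s * i ∈ I := I.sub_mem ht' (I.mul_mem_left _ hi)
        convert h4 using 1; ring
    exact fun t ht => hN ht
  refine ⟨key, ?_, ?_⟩
  · intro t ht
    obtain ⟨i, hi, w, hw, hiw⟩ := Submodule.mem_sup.1 ht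
    obtain ⟨t', rfl⟩ := Ideal.mem_span_singleton'.1 hw
    have h4 : s * t' ∈ I ⊔ Ideal.span {r} := by
      have : s * t' = - i + t * r := by linear_combination hiw
      rw [this]
      exact Submodule.add_mem_sup (I.neg_mem hi) (Ideal.mem_span_singleton'.2 ⟨t, rfl⟩)
    obtain ⟨j, hj, w, hw', hjw⟩ := Submodule.mem_sup.1 (h2 _ h4)
    obtain ⟨t'', rfl⟩ := Ideal.mem_span_singleton'.1 hw'
    have h5 : t - s * t'' ∈ I := by
      refine h1 _ ?_
      have : r * (t - s * t'') = i + s * j := by rw [← hjw] at hiw; linear_combination -hiw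
      rw [this]
      exact I.add_mem hi (I.mul_mem_left _ hj)
    have : t = (t - s * t'') + t'' * s := by ring
    rw [this]
    exact Submodule.add_mem_sup h5 (Ideal.mem_span_singleton'.2 ⟨t'', rfl⟩)
  · rwa [sup_assoc, sup_comm (Ideal.span {s}), ← sup_assoc]

lemma wreg_perm {L M : List A} (hp : L.Perm M) (I : Ideal A)
    (hL : ∀ x ∈ L, x ∈ IsLocalRing.maximalIdeal A) (h : wreg I L) : wreg I M := by
  induction hp generalizing I with
  | nil => exact h
  | cons x _ ih => exact ⟨h.1, ih _ (fun y hy => hL y (by simp [hy])) h.2⟩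
  | swap x y l => exact wreg_swap I y x l (hL y (by simp)) h
  | trans h1 h2 ih1 ih2 =>
    exact ih2 I (fun y hy => hL y (h1.mem_iff.2 hy)) (ih1 I hL h)

lemma wreg_exchange (J : Ideal A) (x y : A) (hx : wreg J [x])
    (hxy : x ∈ (J ⊔ Ideal.span {y}).radical) : wreg J [y] := by
  refine ⟨?_, trivial⟩
  obtain ⟨k, hk⟩ := hxy
  obtain ⟨i, hi, w, hw, hiw⟩ := Submodule.mem_sup.1 hk
  obtain ⟨c, rfl⟩ := Ideal.mem_span_singleton'.1 hw
  intro t ht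
  have h1 : x ^ k * t ∈ J := by
    rw [← hiw]
    have := J.add_mem (J.mul_mem_right t hi) (J.mul_mem_left c ht)
    convert this using 1; ring
  clear hk hiw
  induction k with
  | zero => simpa using h1
  | succ k ih => exact ih (hx.1 _ (by rwa [pow_succ', mul_assoc] at h1))

lemma radical_of_avoid (J : Ideal A) (x z : A)
    (hx : IsLocalRing.maximalIdeal A ≤ (J ⊔ Ideal.span {x}).radical)
    (hxm : x ∈ IsLocalRing.maximalIdeal A)
    (hz : ∀ Q ∈ J.minimalPrimes, z ∉ Q) :
    IsLocalRing.maximalIdeal A ≤ (J ⊔ Ideal.span {z}).radical := by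
  rw [Ideal.radical_eq_sInf]
  refine le_sInf ?_
  rintro P ⟨hJP, hP⟩
  have hzP : z ∈ P := hJP (Ideal.mem_sup_right (Ideal.mem_span_singleton_self z))
  obtain ⟨Q, hQ, hQP⟩ := Ideal.exists_minimalPrimes_le (le_sup_left.trans hJP)
  have hQprime : Q.IsPrime := hQ.1.1
  by_contra hcon
  have hPm : P ≤ IsLocalRing.maximalIdeal A := IsLocalRing.le_maximalIdeal hP.ne_top
  have hQP' : ¬ P ≤ Q := fun h => hz Q hQ (h hzP)
  have hmin : IsLocalRing.maximalIdeal A ∈ (Q ⊔ Ideal.span {x}).minimalPrimes := by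
    refine ⟨⟨inferInstance, sup_le (hQP.trans hPm) ?_⟩, ?_⟩
    · rwa [Ideal.span_singleton_le_iff_mem]
    · rintro P' ⟨hP', hle⟩ -
      refine hx.trans (hP'.radical_le_iff.2 ?_)
      exact le_trans (sup_le_sup_right hQ.1.2 _) hle
  have h1 := Ideal.map_height_le_one_of_mem_minimalPrimes hmin
  have hsurj : Function.Surjective (Ideal.Quotient.mk Q) := Ideal.Quotient.mk_surjective
  have hk : ∀ P' : Ideal A, Q ≤ P' → RingHom.ker (Ideal.Quotient.mk Q) ≤ P' := by
    intro P' h; rwa [Ideal.mk_ker]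
  have hcm : ∀ P' : Ideal A, Q ≤ P' →
      Ideal.comap (Ideal.Quotient.mk Q) (Ideal.map (Ideal.Quotient.mk Q) P') = P' := by
    intro P' h
    rw [Ideal.comap_map_of_surjective _ hsurj, ← RingHom.ker_eq_comap_bot, Ideal.mk_ker]
    exact sup_eq_left.2 h
  have := Ideal.map_isPrime_of_surjective hsurj (hk P hQP)
  have := Ideal.map_isPrime_of_surjective hsurj (hk _ (hQP.trans hPm))
  have l1 : Ideal.map (Ideal.Quotient.mk Q) P <
      Ideal.map (Ideal.Quotient.mk Q) (IsLocalRing.maximalIdeal A) := by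
    refine lt_of_le_not_ge (Ideal.map_mono hPm) fun h => hcon ?_
    have := Ideal.comap_mono (f := Ideal.Quotient.mk Q) h
    rwa [hcm _ hQP, hcm _ (hQP.trans hPm)] at this
  have l2 : (⊥ : Ideal (A ⧸ Q)) < Ideal.map (Ideal.Quotient.mk Q) P := by
    refine bot_lt_iff_ne_bot.2 fun h => hQP' ?_
    have := hcm P hQP
    rw [h, ← RingHom.ker_eq_comap_bot, Ideal.mk_ker] at this
    exact this.ge
  have e1 := Ideal.height_add_one_le_of_lt_of_isPrime l1
  have e2 := Ideal.height_add_one_le_of_lt_of_isPrime l2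
  have e3 : (2 : ℕ∞) ≤ 1 := by
    calc (2 : ℕ∞) = 1 + 1 := by norm_num
      _ ≤ _ + 1 := by gcongr; exact le_trans le_add_self e2
      _ ≤ _ := e1
      _ ≤ 1 := h1
  exact absurd e3 (by decide)

lemma exists_avoid (J J' : Ideal A)
    (hJ : ¬ IsLocalRing.maximalIdeal A ≤ J.radical)
    (hJ' : ¬ IsLocalRing.maximalIdeal A ≤ J'.radical) :
    ∃ z ∈ IsLocalRing.maximalIdeal A, (∀ Q ∈ J.minimalPrimes, z ∉ Q) ∧
      (∀ Q ∈ J'.minimalPrimes, z ∉ Q) := by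
  by_contra hcon
  push Not at hcon
  have hfin : (J.minimalPrimes ∪ J'.minimalPrimes).Finite :=
    (Ideal.finite_minimalPrimes_of_isNoetherianRing A J).union
      (Ideal.finite_minimalPrimes_of_isNoetherianRing A J')
  have := (Ideal.subset_union_prime_finite hfin (f := id) ⊥ ⊥
    (I := IsLocalRing.maximalIdeal A) (by
      rintro i (hi | hi) _ _
      · exact hi.1.1
      · exact hi.1.1)).1 (by
      intro z hz
      simp only [Set.mem_iUnion, id]
      by_cases h : ∀ Q ∈ J.minimalPrimes, z ∉ Q
      · obtain ⟨Q, hQ, hzQ⟩ := hcon z hz h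
        exact ⟨Q, Or.inr hQ, hzQ⟩
      · push Not at h
        obtain ⟨Q, hQ, hzQ⟩ := h
        exact ⟨Q, Or.inl hQ, hzQ⟩)
  obtain ⟨Q, hQ, hle⟩ := this
  have aux : ∀ J : Ideal A, ¬ IsLocalRing.maximalIdeal A ≤ J.radical →
      Q ∈ J.minimalPrimes → False := by
    intro J hJ hQ
    apply hJ
    have hQm : Q = IsLocalRing.maximalIdeal A :=
      le_antisymm (IsLocalRing.le_maximalIdeal hQ.1.1.ne_top) hle
    rw [Ideal.radical_eq_sInf]
    refine le_sInf ?_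
    rintro P ⟨hJP, hP⟩
    rw [← hQm]
    exact hQ.2 ⟨hP, hJP⟩ (hQm ▸ IsLocalRing.le_maximalIdeal hP.ne_top)
  rcases hQ with hQ | hQ
  · exact aux J hJ hQ
  · exact aux J' hJ' hQ

/-- If one system of parameters is a regular sequence, then all are. -/
lemma wreg_of_sop (N : ℕ) : ∀ (I : Ideal A) (L M : List A), L.length = N → M.length = N →
    (∀ x ∈ L, x ∈ IsLocalRing.maximalIdeal A) →
    (∀ x ∈ M, x ∈ IsLocalRing.maximalIdeal A) →
    wreg I L →
    IsLocalRing.maximalIdeal A ≤ (I ⊔ Ideal.ofList L).radical →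
    IsLocalRing.maximalIdeal A ≤ (I ⊔ Ideal.ofList M).radical →
    (∀ M' : List A, M'.length < N → (∀ x ∈ M', x ∈ IsLocalRing.maximalIdeal A) →
      ¬ IsLocalRing.maximalIdeal A ≤ (I ⊔ Ideal.ofList M').radical) →
    wreg I M := by
  induction N with
  | zero =>
    intro I L M _ hM _ _ _ _ _ _
    rw [List.length_eq_zero_iff.1 hM]; trivial
  | succ N ih =>
    intro I L M hL hM hLm hMm hreg hLr hMr hdim
    obtain ⟨x, L, rfl⟩ := List.exists_cons_of_length_eq_add_one hL
    obtain ⟨y, M, rfl⟩ := List.exists_cons_of_length_eq_add_one hM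
    simp only [List.length_cons, add_left_inj] at hL hM
    obtain ⟨z, hzm, hz1, hz2⟩ := exists_avoid (I ⊔ Ideal.ofList L) (I ⊔ Ideal.ofList M)
      (hdim L (by omega) fun w hw => hLm w (by simp [hw]))
      (hdim M (by omega) fun w hw => hMm w (by simp [hw]))
    have hxm := hLm x (by simp)
    have hym := hMm y (by simp)
    have hLm' : ∀ w ∈ L, w ∈ IsLocalRing.maximalIdeal A := fun w hw => hLm w (by simp [hw])
    have hMm' : ∀ w ∈ M, w ∈ IsLocalRing.maximalIdeal A := fun w hw => hMm w (by simp [hw])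
    rw [Ideal.ofList_cons, sup_comm (Ideal.span _), ← sup_assoc] at hLr hMr
    have hLz := radical_of_avoid _ x z hLr hxm hz1
    have hMz := radical_of_avoid _ y z hMr hym hz2
    have s1 : wreg I (L ++ [x]) := wreg_perm (List.perm_append_singleton x L).symm I hLm hreg
    have s2 : wreg I (L ++ [z]) := by
      rw [wreg_append] at s1 ⊢
      exact ⟨s1.1, wreg_exchange _ x z s1.2 (hLz hxm)⟩
    have s3 : wreg I (z :: L) := wreg_perm (List.perm_append_singleton z L) I (by
      intro w hw
      rcases List.mem_append.1 hw with h | h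
      · exact hLm' w h
      · rw [List.mem_singleton.1 h]; exact hzm) s2
    have s4 : wreg (I ⊔ Ideal.span {z}) M := by
      refine ih _ L M hL hM hLm' hMm' s3.2 ?_ ?_ ?_
      · rwa [sup_assoc, sup_comm (Ideal.span _), ← sup_assoc]
      · rwa [sup_assoc, sup_comm (Ideal.span _), ← sup_assoc]
      · intro M' hM' hM'm
        rw [sup_assoc, ← Ideal.ofList_cons]
        refine hdim _ (by simpa using hM') ?_
        intro w hw
        rcases List.mem_cons.1 hw with h | h
        · rw [h]; exact hzm
        · exact hM'm w h
    have s5 : wreg I (z :: M) := ⟨s3.1, s4⟩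
    have s6 : wreg I (M ++ [z]) := wreg_perm (List.perm_append_singleton z M).symm I (by
      intro w hw
      rcases List.mem_cons.1 hw with h | h
      · rw [h]; exact hzm
      · exact hMm' w h) s5
    have s7 : wreg I (M ++ [y]) := by
      rw [wreg_append] at s6 ⊢
      exact ⟨s6.1, wreg_exchange _ z y s6.2 (hMr hzm)⟩
    exact wreg_perm (List.perm_append_singleton y M) I (by
      intro w hw
      rcases List.mem_append.1 hw with h | h
      · exact hMm' w h
      · rw [List.mem_singleton.1 h]; exact hym) s7

/-- Hartshorne's connectedness argument. -/
lemma connectedness (I J₁ J₂ : Ideal A) (x y : A)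
    (hreg : wreg I [x, y]) (hprod : J₁ * J₂ ≤ I)
    (hx : x ∈ J₁ ⊔ J₂) (hy : y ∈ J₁ ⊔ J₂) : J₁ ≤ I ∨ J₂ ≤ I := by
  obtain ⟨a, ha, b, hb, hab⟩ := Submodule.mem_sup.1 hx
  obtain ⟨c, hc, e, he, hce⟩ := Submodule.mem_sup.1 hy
  have hm : ∀ s ∈ J₁, ∀ t ∈ J₂, s * t ∈ I := fun s hs t ht => hprod (Ideal.mul_mem_mul hs ht)
  obtain ⟨h1, h2, -⟩ := hreg
  have h3 : y * a - x * c ∈ I := by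
    have : y * a - x * c = a * e - c * b := by rw [← hab, ← hce]; ring
    rw [this]
    exact I.sub_mem (hm _ ha _ he) (hm _ hc _ hb)
  have h4 : y * a ∈ I ⊔ Ideal.span {x} := by
    have : y * a = (y * a - x * c) + c * x := by ring
    rw [this]
    exact Submodule.add_mem_sup h3 (Ideal.mem_span_singleton'.2 ⟨c, rfl⟩)
  obtain ⟨i, hi, w, hw, hiw⟩ := Submodule.mem_sup.1 (h2 _ h4)
  obtain ⟨t, rfl⟩ := Ideal.mem_span_singleton'.1 hw
  -- a = i + t x, b = x - a
  have h6 : t * (1 - t) ∈ I := by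
    refine h1 _ (h1 _ ?_)
    have : x * (x * (t * (1 - t))) = a * b - i * b - t * x * (-i) := by
      have hb' : b = x - a := by rw [← hab]; ring
      rw [hb', ← hiw]; ring
    rw [this]
    exact I.sub_mem (I.sub_mem (hm _ ha _ hb) (I.mul_mem_right _ hi))
      (I.mul_mem_left _ (I.neg_mem hi))
  rcases IsLocalRing.isUnit_or_isUnit_one_sub_self t with ht | ht
  · -- 1 - t ∈ I, so b ∈ I, x ∈ J₁ + I
    right
    have h7 : 1 - t ∈ I := (Ideal.unit_mul_mem_iff_mem I ht).1 h6
    have hbI : b ∈ I := by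
      have : b = x * (1 - t) - i := by
        have hb' : b = x - a := by rw [← hab]; ring
        rw [hb', ← hiw]; ring
      rw [this]
      exact I.sub_mem (I.mul_mem_left _ h7) hi
    intro s hs
    refine h1 _ ?_
    rw [← hab, add_mul]
    exact I.add_mem (hm _ ha _ hs) (I.mul_mem_right _ hbI)
  · left
    have h7 : t ∈ I := (Ideal.mul_unit_mem_iff_mem I ht).1 h6
    have haI : a ∈ I := by
      rw [← hiw]
      exact I.add_mem hi (I.mul_mem_right _ h7)
    intro s hs
    refine h1 _ ?_
    rw [← hab, add_mul]
    refine I.add_mem (I.mul_mem_right _ haI) ?_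
    rw [mul_comm]; exact hm _ hs _ hb

end local_part

section poly_part

variable {σ : Type*} {K : Type*} [Field K]

/-- Substitution `X_i ↦ P_i` for `i ∈ S`. -/
noncomputable def subst (P : σ → K) (S : Set σ) : MvPolynomial σ K →ₐ[K] MvPolynomial σ K :=
  open Classical in aeval (fun i => if i ∈ S then C (P i) else X i)

/-- The ideal generated by `X_i - P_i`, `i ∈ S`. -/
noncomputable def QI (P : σ → K) (S : Set σ) : Ideal (MvPolynomial σ K) :=
  Ideal.span ((fun i => X i - C (P i)) '' S)

lemma sub_subst_mem (P : σ → K) (S : Set σ) (r : MvPolynomial σ K) :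
    r - subst P S r ∈ QI P S := by
  classical
  induction r using MvPolynomial.induction_on with
  | C a => simp [subst]
  | add p q hp hq =>
    have := (QI P S).add_mem hp hq
    rw [map_add]
    convert this using 1; ring
  | mul_X p i hp =>
    rw [map_mul]
    have h2 : X i - subst P S (X i) ∈ QI P S := by
      simp only [subst, aeval_X]
      split_ifs with hi
      · exact Ideal.subset_span ⟨i, hi, rfl⟩
      · simp
    have := (QI P S).add_mem ((QI P S).mul_mem_right (X i) hp)
      ((QI P S).mul_mem_left (subst P S p) h2)
    convert this using 1; ring

lemma QI_eq_ker (P : σ → K) (S : Set σ) : QI P S = RingHom.ker (subst P S) := by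
  classical
  apply le_antisymm
  · rw [QI, Ideal.span_le]
    rintro _ ⟨i, hi, rfl⟩
    simp [RingHom.mem_ker, subst, hi]
  · intro r hr
    have := sub_subst_mem P S r
    rw [RingHom.mem_ker] at hr
    rwa [hr, sub_zero] at this

instance (P : σ → K) (S : Set σ) : (QI P S).IsPrime := by
  rw [QI_eq_ker]; exact RingHom.ker_isPrime _

lemma notMem_QI (P : σ → K) (S : Set σ) {i : σ} (hi : i ∉ S) : X i - C (P i) ∉ QI P S := by
  classical
  rw [QI_eq_ker, RingHom.mem_ker]
  simp only [subst, map_sub, aeval_X, hi, if_false, algHom_C, algebraMap_eq]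
  intro h
  have := congrArg (eval (fun j => P j + 1)) h
  simp at this

lemma QI_insert (P : σ → K) (S : Set σ) (i : σ) :
    QI P (insert i S) = QI P S ⊔ Ideal.span {X i - C (P i)} := by
  rw [QI, QI, Set.image_insert_eq, Ideal.span_insert, sup_comm]

lemma height_QI (P : σ → K) (S : Finset σ) : (S.card : ℕ∞) ≤ (QI P (S : Set σ)).height := by
  classical
  induction S using Finset.induction_on with
  | empty => simp
  | insert i S hi ih =>
    have hlt : QI P (S : Set σ) < QI P ((insert i S : Finset σ) : Set σ) := by
      rw [Finset.coe_insert, QI_insert]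
      refine lt_of_le_not_ge le_sup_left fun h => notMem_QI P (S : Set σ) (i := i) (by simpa) ?_
      exact h (Ideal.mem_sup_right (Ideal.mem_span_singleton_self _))
    have := Ideal.height_add_one_le_of_lt_of_isPrime hlt
    rw [Finset.card_insert_of_notMem hi]
    rw [Nat.cast_add, Nat.cast_one]
    exact le_trans (add_le_add_left ih 1) this

lemma wreg_QI (P : σ → K) (m : Ideal (MvPolynomial σ K)) [m.IsPrime]
    (hm : ∀ S, QI P S ≤ m) (l : List σ) :
    ∀ S : Set σ, l.Nodup → (∀ i ∈ l, i ∉ S) →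
    wreg (Ideal.map (algebraMap _ (Localization.AtPrime m)) (QI P S))
      (l.map (fun i => algebraMap _ (Localization.AtPrime m) (X i - C (P i)))) := by
  induction l with
  | nil => intro S _ _; trivial
  | cons i l ih =>
    intro S hnd hS
    rw [List.nodup_cons] at hnd
    refine ⟨?_, ?_⟩
    · intro t ht
      obtain ⟨⟨a, s⟩, rfl⟩ := IsLocalization.mk'_surjective m.primeCompl t
      have h1 : algebraMap _ (Localization.AtPrime m) ((X i - C (P i)) * a) ∈
          Ideal.map (algebraMap _ (Localization.AtPrime m)) (QI P S) := by
        have := Ideal.mul_mem_left _ (algebraMap _ (Localization.AtPrime m) (s : MvPolynomial σ K)) ht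
        convert this using 1
        rw [mul_left_comm, IsLocalization.mk'_spec', map_mul]
      rw [IsLocalization.algebraMap_mem_map_algebraMap_iff m.primeCompl] at h1
      obtain ⟨c, hc, hc2⟩ := h1
      have h2 : a ∈ QI P S := by
        rcases (inferInstance : (QI P S).IsPrime).mem_or_mem hc2 with h | h
        · exact absurd (hm S h) hc
        · rcases (inferInstance : (QI P S).IsPrime).mem_or_mem h with h | h
          · exact absurd h (notMem_QI P S (hS i (by simp)))
          · exact h
      change IsLocalization.mk' (Localization.AtPrime m) a s ∈ _
      rw [IsLocalization.mk'_eq_mul_mk'_one]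
      exact Ideal.mul_mem_right _ _ (Ideal.mem_map_of_mem _ h2)
    · have := ih (insert i S) hnd.2 (by
        intro j hj
        rw [Set.mem_insert_iff, not_or]
        exact ⟨fun h => hnd.1 (h ▸ hj), hS j (by simp [hj])⟩)
      rwa [QI_insert, Ideal.map_sup, Ideal.map_span, Set.image_singleton] at this

lemma map_ofList {R S : Type*} [CommRing R] [CommRing S] (f : R →+* S) (l : List R) :
    Ideal.map f (Ideal.ofList l) = Ideal.ofList (l.map f) := by
  induction l with
  | nil => simp [Ideal.map_bot]
  | cons a l ih => simp [Ideal.ofList_cons, Ideal.map_sup, ih, Ideal.map_span]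

theorem poly_connectedness [IsAlgClosed K] [Fintype σ] (P : σ → K)
    (M : List (MvPolynomial σ K)) (x y : MvPolynomial σ K)
    (hlen : M.length + 2 = Fintype.card σ)
    (hzero : ∀ w : σ → K, (∀ r ∈ M ++ [x, y], eval w r = 0) ↔ w = P)
    (J₁ J₂ : Ideal (MvPolynomial σ K)) (hJ : J₁ * J₂ ≤ Ideal.ofList M)
    (hx : x ∈ J₁ ⊔ J₂) (hy : y ∈ J₁ ⊔ J₂) :
    (∀ a ∈ J₁, ∃ s, eval P s ≠ 0 ∧ s * a ∈ Ideal.ofList M) ∨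
    (∀ a ∈ J₂, ∃ s, eval P s ≠ 0 ∧ s * a ∈ Ideal.ofList M) := by
  classical
  let m : Ideal (MvPolynomial σ K) := vanishingIdeal K {P}
  have hmem : ∀ r, r ∈ m ↔ eval P r = 0 := by
    intro r
    simp [m, aeval_eq_eval]
  have hm : ∀ S, QI P S ≤ m := by
    intro S
    rw [QI, Ideal.span_le]
    rintro _ ⟨i, -, rfl⟩
    simp [hmem]
  let A := Localization.AtPrime m
  let ι : MvPolynomial σ K →+* A := algebraMap _ A
  have hιm : ∀ r, eval P r = 0 → ι r ∈ IsLocalRing.maximalIdeal A := by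
    intro r hr
    rw [← Localization.AtPrime.map_eq_maximalIdeal]
    exact Ideal.mem_map_of_mem _ ((hmem r).2 hr)
  have hnull : ∀ L : List (MvPolynomial σ K), (∀ w : σ → K, (∀ r ∈ L, eval w r = 0) → w = P) →
      IsLocalRing.maximalIdeal A ≤ (⊥ ⊔ Ideal.ofList (L.map ι)).radical := by
    intro L hL
    rw [← Localization.AtPrime.map_eq_maximalIdeal, bot_sup_eq, ← map_ofList]
    refine le_trans (Ideal.map_mono ?_) (Ideal.map_radical_le _)
    rw [← vanishingIdeal_zeroLocus_eq_radical (K := K)]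
    refine vanishingIdeal_anti_mono ?_
    intro w hw
    rw [Set.mem_singleton_iff]
    refine hL w fun r hr => ?_
    have := hw r (Ideal.subset_span hr)
    rwa [aeval_eq_eval] at this
  have hL : wreg ⊥ ((Finset.univ : Finset σ).toList.map fun i => ι (X i - C (P i))) := by
    have := wreg_QI P m hm (Finset.univ : Finset σ).toList ∅ (Finset.nodup_toList _) (by simp)
    simpa [QI, Ideal.map_bot] using this
  have hheight : (Fintype.card σ : ℕ∞) ≤ (IsLocalRing.maximalIdeal A).height := by
    have h1 := height_QI P (Finset.univ : Finset σ)
    have h2 := h1.trans (Ideal.height_mono (hm _))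
    have h3 : ((IsLocalRing.maximalIdeal A).height : WithBot ℕ∞) = m.height := by
      rw [IsLocalRing.maximalIdeal_height_eq_ringKrullDim]
      exact IsLocalization.AtPrime.ringKrullDim_eq_height m A
    rw [WithBot.coe_inj.1 h3]
    exact h2
  have hreg : wreg (⊥ : Ideal A) ((M ++ [x, y]).map ι) := by
    refine wreg_of_sop (Fintype.card σ) ⊥
      ((Finset.univ : Finset σ).toList.map fun i => ι (X i - C (P i))) _
      (by simp) (by simp [← hlen]) ?_ ?_ hL ?_ (hnull _ fun w => (hzero w).1) ?_
    · intro w hw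
      obtain ⟨i, -, rfl⟩ := List.mem_map.1 hw
      exact hιm _ (by simp)
    · intro w hw
      obtain ⟨r, hr, rfl⟩ := List.mem_map.1 hw
      exact hιm _ ((hzero P).2 rfl r hr)
    · have := hnull ((Finset.univ : Finset σ).toList.map fun i => (X i - C (P i))) (by
        intro w hw
        funext i
        have := hw (X i - C (P i)) (List.mem_map.2 ⟨i, by simp, rfl⟩)
        simpa [sub_eq_zero] using this)
      rw [List.map_map] at this
      exact this
    · intro M' hM' hM'm hle
      rw [bot_sup_eq] at hle
      have hmin : IsLocalRing.maximalIdeal A ∈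
          (Ideal.span ((M'.toFinset : Finset A) : Set A)).minimalPrimes := by
        have e : Ideal.span ((M'.toFinset : Finset A) : Set A) = Ideal.ofList M' := by
          rw [Ideal.ofList]; congr 1; ext; simp
        rw [e]
        refine ⟨⟨inferInstance, ?_⟩, ?_⟩
        · rw [Ideal.ofList, Ideal.span_le]; exact hM'm
        · rintro Q ⟨hQ, hQ2⟩ -
          exact hle.trans (hQ.radical_le_iff.2 hQ2)
      have h1 := Ideal.height_le_card_of_mem_minimalPrimes_span_finset hmin
      have h2 : (Fintype.card σ : ℕ∞) ≤ (M'.toFinset.card : ℕ∞) := hheight.trans h1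
      have h3 : Fintype.card σ ≤ M'.toFinset.card := by exact_mod_cast h2
      have := List.toFinset_card_le M'
      omega
  rw [List.map_append, wreg_append, bot_sup_eq, ← map_ofList] at hreg
  have hc := connectedness (Ideal.map ι (Ideal.ofList M)) (Ideal.map ι J₁) (Ideal.map ι J₂)
    (ι x) (ι y) hreg.2 (by rw [← Ideal.map_mul]; exact Ideal.map_mono hJ)
    (by rw [← Ideal.map_sup]; exact Ideal.mem_map_of_mem _ hx)
    (by rw [← Ideal.map_sup]; exact Ideal.mem_map_of_mem _ hy)
  have fin : ∀ J : Ideal (MvPolynomial σ K), Ideal.map ι J ≤ Ideal.map ι (Ideal.ofList M) →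
      ∀ a ∈ J, ∃ s, eval P s ≠ 0 ∧ s * a ∈ Ideal.ofList M := by
    intro J hJ a ha
    have := hJ (Ideal.mem_map_of_mem _ ha)
    rw [IsLocalization.algebraMap_mem_map_algebraMap_iff m.primeCompl] at this
    obtain ⟨s, hs, hsa⟩ := this
    exact ⟨s, fun h => hs ((hmem s).2 h), hsa⟩
  exact hc.imp (fin J₁) (fin J₂)

end poly_part

section main_part

variable {K : Type*} [Field K]

/-- Homogenized geometric sum. -/
noncomputable def gs {R : Type*} [CommRing R] (r : ℕ) (Y X : R) : R :=
  ∑ s ∈ Finset.range r, Y ^ s * X ^ (r - 1 - s)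

lemma gs_mul {R : Type*} [CommRing R] (r : ℕ) (ρ X : R) :
    gs r (ρ * X) X = (∑ s ∈ Finset.range r, ρ ^ s) * X ^ (r - 1) := by
  rw [gs, Finset.sum_mul]
  refine Finset.sum_congr rfl fun s hs => ?_
  have hs := Finset.mem_range.1 hs
  rw [mul_pow, mul_assoc, ← pow_add]
  congr 2; omega

lemma gs_one (r : ℕ) (X : K) : gs r X X = r * X ^ (r - 1) := by
  have := gs_mul r 1 X
  simpa using this

lemma gs_zero (r : ℕ) (ρ X : K) (h : ρ ^ r = 1) (h1 : ρ ≠ 1) : gs r (ρ * X) X = 0 := by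
  rw [gs_mul]
  have := geom_sum_mul ρ r
  rw [h, sub_self] at this
  rw [(mul_eq_zero.1 this).resolve_right (sub_ne_zero.2 h1), zero_mul]

lemma map_gs {R S : Type*} [CommRing R] [CommRing S] (φ : R →+* S) (r : ℕ) (Y X : R) :
    φ (gs r Y X) = gs r (φ Y) (φ X) := by
  simp [gs, map_sum]

lemma pow_eq_one_iff_of_coprime' {θ : K} {r E : ℕ} (h : θ ^ r = 1) (hc : Nat.Coprime r E) :
    θ ^ E = 1 ↔ θ = 1 := by
  constructor
  · intro h2
    have h3 := Nat.dvd_gcd (orderOf_dvd_of_pow_eq_one h) (orderOf_dvd_of_pow_eq_one h2)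
    rw [hc] at h3
    exact orderOf_eq_one_iff.1 (Nat.dvd_one.1 h3)
  · rintro rfl; simp

variable {n : ℕ} (d f g h : Fin (n - 1) → ℕ)

/-- Embedding of the first `n-1` indices. -/
def cl (l : Fin (n - 1)) : Fin n := Fin.castLE (by omega) l

/-- The last index. -/
def la (hn : 3 ≤ n) : Fin n := ⟨n - 1, by omega⟩

lemma phi_xl (u : Fin n → K) (l : Fin (n - 1)) :
    phiMap n d f g h u (Sum.inl (cl l)) = u (cl l) ^ d l := by
  simp [phiMap, cl]

lemma phi_xn (hn : 3 ≤ n) (u : Fin n → K) :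
    phiMap n d f g h u (Sum.inl (la hn)) = u (la hn) := by
  simp [phiMap, la]

lemma phi_yl (hn : 3 ≤ n) (u : Fin n → K) (l : Fin (n - 1)) :
    phiMap n d f g h u (Sum.inr (cl l)) = u (cl l) ^ f l * u (la hn) ^ g l := by
  simp [phiMap, cl, la]

lemma phi_yn (hn : 3 ≤ n) (u : Fin n → K) :
    phiMap n d f g h u (Sum.inr (la hn)) = ∏ l, u (cl l) ^ h l := by
  simp [phiMap, cl, la]

lemma idx_cases (hn : 3 ≤ n) (k : Fin n) : (∃ l, k = cl l) ∨ k = la hn := by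
  by_cases hk : k.1 < n - 1
  · left; exact ⟨⟨k.1, hk⟩, by ext; simp [cl]⟩
  · right; ext; simp [la]; omega

/-- Assemble a parameter vector from its first `n-1` entries, with last entry zero. -/
def mkU (u : Fin (n - 1) → K) : Fin n → K :=
  fun k => if hk : k.1 < n - 1 then u ⟨k.1, hk⟩ else 0

lemma mkU_cl (u : Fin (n - 1) → K) (l : Fin (n - 1)) : mkU u (cl l) = u l := by
  simp [mkU, cl]

lemma mkU_la (hn : 3 ≤ n) (u : Fin (n - 1) → K) : mkU u (la hn) = 0 := by
  simp [mkU, la]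

theorem main_aux [IsAlgClosed K] (hn : 3 ≤ n)
    (hd : ∀ i, 0 < d i) (hg : ∀ i, 0 < g i) (hh : ∀ i, 0 < h i)
    (hdf : ∀ i, Nat.Coprime (d i) (f i))
    (hdh : ∀ i, Nat.Coprime (d i) (h i))
    (hdd : ∀ i j, i ≠ j → Nat.Coprime (d i) (d j))
    (r : ℕ) (hr : r.Prime) (hrK : (r : K) ≠ 0) (i j : Fin (n - 1)) (hij : i ≠ j)
    (hrd : r ∣ d j) (G : Fin n → MvPolynomial (Fin n ⊕ Fin n) K)
    (hG : {w : Fin n ⊕ Fin n → K | ∀ k, MvPolynomial.eval w (G k) = 0}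
        = Set.range (phiMap n d f g h)) : False := by
  classical
  obtain ⟨e, he⟩ := hrd
  have hepos : 0 < e := Nat.pos_of_ne_zero (by rintro rfl; have := hd j; omega)
  -- the product of the `d l`, `l ≠ j`
  let N := ∏ l ∈ Finset.univ.erase j, d l
  have hdN : ∀ l, l ≠ j → d l ∣ N := fun l hl => Finset.dvd_prod_of_mem d (by simp [hl])
  have hNr : Nat.Coprime r N := by
    refine Nat.Coprime.prod_right fun l hl => ?_
    exact Nat.Coprime.coprime_dvd_left ⟨e, he⟩ (hdd j l (Finset.ne_of_mem_erase hl).symm)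
  obtain ⟨N', hN'⟩ := hdN i hij
  have hNpos : 0 < N := Finset.prod_pos fun l _ => hd l
  have hN'pos : 0 < N' := Nat.pos_of_ne_zero (by rintro rfl; omega)
  let α := h i * N' * e
  have hα : 0 < α := by have := hh i; positivity
  let γ := g j * e
  have hγ : 0 < γ := by have := hg j; positivity
  let vX : MvPolynomial (Fin n ⊕ Fin n) K := X (Sum.inl (cl i)) ^ α
  let vY : MvPolynomial (Fin n ⊕ Fin n) K := X (Sum.inr (la hn)) ^ (N * e)
  let vZ : MvPolynomial (Fin n ⊕ Fin n) K := X (Sum.inl (la hn)) ^ γ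
  let vT : MvPolynomial (Fin n ⊕ Fin n) K := X (Sum.inr (cl j)) ^ e
  let good : (Fin n → K) → Prop := fun u => ∀ l, l ≠ i → u (cl l) ^ d l = 1
  let ph := phiMap (K := K) n d f g h
  have eX : ∀ u, eval (ph u) vX = (u (cl i) ^ d i) ^ α := by
    intro u; simp only [vX, map_pow, eval_X, ph, phi_xl]
  have eZ : ∀ u, eval (ph u) vZ = u (la hn) ^ γ := by
    intro u; simp only [vZ, map_pow, eval_X, ph, phi_xn]
  have eT : ∀ u, eval (ph u) vT = (u (cl j) ^ e) ^ f j * eval (ph u) vZ := by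
    intro u
    rw [eZ]
    simp only [vT, map_pow, eval_X, ph, phi_yl d f g h hn, γ]
    rw [mul_pow]; ring
  have eY : ∀ u, good u → eval (ph u) vY = (u (cl j) ^ e) ^ (h j * N) * eval (ph u) vX := by
    intro u hu
    rw [eX]
    simp only [vY, map_pow, eval_X, ph, phi_yn d f g h hn, α]
    rw [← Finset.prod_pow, ← Finset.mul_prod_erase _ _ (Finset.mem_univ j),
      ← Finset.mul_prod_erase _ _ (Finset.mem_erase.2 ⟨hij, Finset.mem_univ i⟩),
      Finset.prod_eq_one, mul_one]
    · congr 1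
      · ring
      · rw [hN']; ring
    · intro l hl
      simp only [Finset.mem_erase, Finset.mem_univ, and_true] at hl
      obtain ⟨c, hc⟩ := hdN l hl.2
      rw [hc, ← pow_mul, show h l * (d l * c * e) = d l * (h l * c * e) by ring, pow_mul,
        hu l hl.1, one_pow]
  have hθ : ∀ u, good u → (u (cl j) ^ e) ^ r = 1 := by
    intro u hu
    rw [← pow_mul, mul_comm, ← he]; exact hu j hij.symm
  have hc1 : Nat.Coprime r (h j * N) :=
    Nat.Coprime.mul_right (Nat.Coprime.coprime_dvd_left ⟨e, he⟩ (hdh j)) hNr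
  have hc2 : Nat.Coprime r (f j) := Nat.Coprime.coprime_dvd_left ⟨e, he⟩ (hdf j)
  let a := gs r vY vX
  let b := C (r : K) * vX ^ (r - 1) - a
  let c := gs r vT vZ
  let b' := C (r : K) * vZ ^ (r - 1) - c
  have ea1 : ∀ u, good u → u (cl j) ^ e = 1 →
      eval (ph u) a = r * eval (ph u) vX ^ (r - 1) := by
    intro u hu h1
    simp only [a, map_gs, eY u hu, h1, one_pow, one_mul, gs_one]
  have ea0 : ∀ u, good u → u (cl j) ^ e ≠ 1 → eval (ph u) a = 0 := by
    intro u hu h1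
    simp only [a, map_gs, eY u hu]
    refine gs_zero _ _ _ ?_ ?_
    · rw [pow_right_comm, hθ u hu, one_pow]
    · rwa [Ne, pow_eq_one_iff_of_coprime' (hθ u hu) hc1]
  have ec1 : ∀ u, good u → u (cl j) ^ e = 1 →
      eval (ph u) c = r * eval (ph u) vZ ^ (r - 1) := by
    intro u hu h1
    simp only [c, map_gs, eT u, h1, one_pow, one_mul, gs_one]
  have ec0 : ∀ u, good u → u (cl j) ^ e ≠ 1 → eval (ph u) c = 0 := by
    intro u hu h1
    simp only [c, map_gs, eT u]
    refine gs_zero _ _ _ ?_ ?_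
    · rw [pow_right_comm, hθ u hu, one_pow]
    · rwa [Ne, pow_eq_one_iff_of_coprime' (hθ u hu) hc2]
  have eb : ∀ u, eval (ph u) b = r * eval (ph u) vX ^ (r - 1) - eval (ph u) a := by
    intro u; simp [b]
  have eb' : ∀ u, eval (ph u) b' = r * eval (ph u) vZ ^ (r - 1) - eval (ph u) c := by
    intro u; simp [b']
  -- the equations
  let M : List (MvPolynomial (Fin n ⊕ Fin n) K) :=
    List.ofFn G ++ (Finset.univ.erase i).toList.map (fun l => X (Sum.inl (cl l)) - 1)
  have hlen : M.length + 2 = Fintype.card (Fin n ⊕ Fin n) := by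
    simp [M]; omega
  have hMz : ∀ w, (∀ s ∈ M, eval w s = 0) ↔ ∃ u, good u ∧ w = ph u := by
    intro w
    constructor
    · intro hw
      have h1 : w ∈ {w : Fin n ⊕ Fin n → K | ∀ k, MvPolynomial.eval w (G k) = 0} :=
        fun k => hw _ (List.mem_append_left _ (by simp [List.mem_ofFn]))
      rw [hG] at h1
      obtain ⟨u, rfl⟩ := h1
      refine ⟨u, fun l hl => ?_, rfl⟩
      have := hw (X (Sum.inl (cl l)) - 1)
        (List.mem_append_right _ (List.mem_map.2 ⟨l, by simp [hl], rfl⟩))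
      simpa [sub_eq_zero, phi_xl] using this
    · rintro ⟨u, hu, rfl⟩ s hs
      rcases List.mem_append.1 hs with hs | hs
      · have h1 : ph u ∈ {w : Fin n ⊕ Fin n → K | ∀ k, MvPolynomial.eval w (G k) = 0} := by
          rw [hG]; exact ⟨u, rfl⟩
        obtain ⟨k, rfl⟩ := (List.mem_ofFn' _ _).1 hs
        exact h1 k
      · obtain ⟨l, hl, rfl⟩ := List.mem_map.1 hs
        have hl : l ≠ i := by simpa using hl
        simp [ph, phi_xl, hu l hl]
  -- the point
  let cu : K → K → Fin n → K := fun ζ t => mkU (fun l => if l = i then t else if l = j then ζ else 1)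
  have hcu : ∀ ζ t, ζ ^ d j = 1 → good (cu ζ t) := by
    intro ζ t hζ l hl
    simp only [cu, mkU_cl, hl, if_false]
    split_ifs with h1
    · rw [h1, hζ]
    · simp
  let P := ph (cu 1 0)
  have huniq : ∀ u, good u → u (cl i) = 0 → u (la hn) = 0 → ph u = P := by
    have aux : ∀ u u', good u → good u' → u (cl i) = 0 → u' (cl i) = 0 → u (la hn) = 0 →
        u' (la hn) = 0 → ph u = ph u' := by
      intro u u' hu hu' h1 h1' h2 h2'
      funext k
      rcases k with k | k
      · rcases idx_cases hn k with ⟨l, rfl⟩ | rfl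
        · simp only [ph, phi_xl]
          by_cases hl : l = i
          · rw [hl, h1, h1']
          · rw [hu l hl, hu' l hl]
        · simp only [ph, phi_xn, h2, h2']
      · rcases idx_cases hn k with ⟨l, rfl⟩ | rfl
        · simp only [ph, phi_yl d f g h hn, h2, h2']
          rw [zero_pow (hg l).ne', mul_zero, mul_zero]
        · simp only [ph, phi_yn d f g h hn]
          rw [Finset.prod_eq_zero (Finset.mem_univ i), Finset.prod_eq_zero (Finset.mem_univ i)]
          · rw [h1', zero_pow (hh i).ne']
          · rw [h1, zero_pow (hh i).ne']
    intro u hu h1 h2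
    exact aux u _ hu (hcu 1 0 (one_pow _)) h1 (by simp [cu, mkU_cl]) h2 (mkU_la hn _)
  -- Nullstellensatz
  let I := Ideal.ofList M
  have hI : ∀ s : MvPolynomial (Fin n ⊕ Fin n) K, s ∈ I → ∀ u, good u → eval (ph u) s = 0 := by
    intro s hs u hu
    have h1 : I ≤ RingHom.ker (eval (ph u)) := by
      simp only [I, Ideal.ofList]
      rw [Ideal.span_le]
      intro s hs
      exact (hMz _).2 ⟨u, hu, rfl⟩ s hs
    exact h1 hs
  have hrad : ∀ s : MvPolynomial (Fin n ⊕ Fin n) K,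
      (∀ u, good u → eval (ph u) s = 0) → s ∈ I.radical := by
    intro s hs
    rw [← vanishingIdeal_zeroLocus_eq_radical (K := K)]
    intro w hw
    have h1 : ∀ s ∈ M, eval w s = 0 := by
      intro s hs
      have := hw s (Ideal.subset_span hs)
      rwa [aeval_eq_eval] at this
    obtain ⟨u, hu, rfl⟩ := (hMz w).1 h1
    rw [aeval_eq_eval]
    exact hs u hu
  let H₁ := Ideal.span {a, c}
  let H₂ := Ideal.span {b, b'}
  have hprod : H₁ * H₂ ≤ I.radical := by
    simp only [H₁, H₂]
    rw [Ideal.span_mul_span', Ideal.span_le]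
    rintro _ ⟨s, hs, t, ht, rfl⟩
    refine hrad _ fun u hu => ?_
    simp only [map_mul]
    by_cases hθ1 : u (cl j) ^ e = 1
    · have : eval (ph u) t = 0 := by
        rcases ht with rfl | rfl
        · rw [eb, ea1 u hu hθ1, sub_self]
        · rw [eb', ec1 u hu hθ1, sub_self]
      rw [this, mul_zero]
    · have : eval (ph u) s = 0 := by
        rcases hs with rfl | rfl
        · rw [ea0 u hu hθ1]
        · rw [ec0 u hu hθ1]
      rw [this, zero_mul]
  obtain ⟨k₀, hk₀⟩ := Ideal.exists_radical_pow_le_of_fg I (IsNoetherian.noetherian _)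
  let k := k₀ + 1
  have hJ : H₁ ^ k * H₂ ^ k ≤ I := by
    rw [← mul_pow]
    exact (Ideal.pow_right_mono hprod k).trans ((Ideal.pow_le_pow_right (Nat.le_succ k₀)).trans hk₀)
  have hsup : ∀ A B v : MvPolynomial (Fin n ⊕ Fin n) K, A ∈ H₁ → B ∈ H₂ →
      B = C (r : K) * v - A → v ^ (k + k) ∈ H₁ ^ k ⊔ H₂ ^ k := by
    intro A B v hA hB hAB
    refine Ideal.sup_pow_add_le_pow_sup_pow (Ideal.pow_mem_pow ?_ _)
    have h1 : A + B ∈ H₁ ⊔ H₂ := Submodule.add_mem_sup hA hB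
    have h2 := Ideal.mul_mem_left _ (C (r : K)⁻¹) h1
    have h3 : C (r : K)⁻¹ * (A + B) = v := by
      rw [hAB, add_sub_cancel, ← mul_assoc, ← C_mul, inv_mul_cancel₀ hrK, C_1, one_mul]
    rwa [h3] at h2
  have hr1 : 0 < r - 1 := by have := hr.two_le; omega
  have hkk : 0 < k + k := by omega
  have hfin := poly_connectedness P M ((vX ^ (r - 1)) ^ (k + k)) ((vZ ^ (r - 1)) ^ (k + k)) hlen
    (by
      intro w
      constructor
      · intro hw
        obtain ⟨u, hu, rfl⟩ := (hMz w).1 fun s hs => hw s (List.mem_append_left _ hs)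
        have h1 := hw _ (List.mem_append_right _ (List.mem_cons_self ..))
        have h2 := hw _ (List.mem_append_right _ (List.mem_cons_of_mem _ (List.mem_cons_self ..)))
        rw [map_pow, map_pow, eX] at h1
        rw [map_pow, map_pow, eZ] at h2
        refine huniq u hu ?_ ?_
        · exact eq_zero_of_pow_eq_zero (eq_zero_of_pow_eq_zero (eq_zero_of_pow_eq_zero
            (eq_zero_of_pow_eq_zero h1)))
        · exact eq_zero_of_pow_eq_zero (eq_zero_of_pow_eq_zero (eq_zero_of_pow_eq_zero h2))
      · rintro rfl s hs
        rcases List.mem_append.1 hs with hs | hs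
        · exact (hMz _).2 ⟨_, hcu 1 0 (one_pow _), rfl⟩ s hs
        · simp only [List.mem_cons, List.not_mem_nil, or_false] at hs
          rcases hs with rfl | rfl
          · rw [map_pow, map_pow, eX]
            simp only [cu, mkU_cl, if_true]
            rw [zero_pow (hd i).ne', zero_pow hα.ne', zero_pow hr1.ne', zero_pow hkk.ne']
          · rw [map_pow, map_pow, eZ]
            simp only [cu, mkU_la]
            rw [zero_pow hγ.ne', zero_pow hr1.ne', zero_pow hkk.ne'])
    (H₁ ^ k) (H₂ ^ k) hJ
    (hsup a b _ (Ideal.subset_span (by simp)) (Ideal.subset_span (by simp)) rfl)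
    (hsup c b' _ (Ideal.subset_span (by simp)) (Ideal.subset_span (by simp)) rfl)
  -- the curves
  have hcurve : ∀ ζ : K, ζ ^ d j = 1 → ∀ A s : MvPolynomial (Fin n ⊕ Fin n) K, eval P s ≠ 0 →
      s * A ^ k ∈ I →
      (∀ t, eval (ph (cu ζ t)) A = r * eval (ph (cu ζ t)) vX ^ (r - 1)) → False := by
    intro ζ hζ A s hs hsA hA
    have hpoly : ∀ m, ∃ Q : Polynomial K, ∀ t, ph (cu ζ t) m = Q.eval t := by
      have h0 : ∀ m, ∃ Q : Polynomial K, ∀ t, cu ζ t m = Q.eval t := by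
        intro m
        rcases idx_cases hn m with ⟨l, rfl⟩ | rfl
        · simp only [cu, mkU_cl]
          split_ifs
          · exact ⟨Polynomial.X, by simp⟩
          · exact ⟨Polynomial.C ζ, by simp⟩
          · exact ⟨1, by simp⟩
        · exact ⟨0, fun t => by simp [cu, mkU_la]⟩
      choose Q hQ using h0
      intro m
      rcases m with m | m
      · rcases idx_cases hn m with ⟨l, rfl⟩ | rfl
        · exact ⟨Q (cl l) ^ d l, fun t => by simp [ph, phi_xl, hQ]⟩
        · exact ⟨Q (la hn), fun t => by simp only [ph, phi_xn, hQ]⟩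
      · rcases idx_cases hn m with ⟨l, rfl⟩ | rfl
        · exact ⟨Q (cl l) ^ f l * Q (la hn) ^ g l, fun t => by
            simp only [ph, phi_yl d f g h hn, hQ, Polynomial.eval_mul, Polynomial.eval_pow]⟩
        · exact ⟨∏ l, Q (cl l) ^ h l, fun t => by
            simp only [ph, phi_yn d f g h hn, hQ, Polynomial.eval_prod, Polynomial.eval_pow]⟩
    choose Q hQ using hpoly
    let F : Polynomial K := aeval Q s
    have hF : ∀ t, F.eval t = eval (ph (cu ζ t)) s := by
      intro t
      have e1 : ph (cu ζ t) = fun m => (Q m).eval t := funext fun m => hQ m t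
      rw [e1]
      have e2 : ((Polynomial.evalRingHom t).comp (aeval Q : _ →ₐ[K] Polynomial K).toRingHom) =
          eval (fun m => (Q m).eval t) := by
        apply MvPolynomial.ringHom_ext
        · intro x; simp
        · intro x; simp
      exact congrArg (fun φ => φ s) e2
    have hz : Polynomial.X * F = 0 := by
      refine Polynomial.funext fun t => ?_
      rw [Polynomial.eval_mul, Polynomial.eval_X, Polynomial.eval_zero, hF]
      by_cases ht : t = 0
      · rw [ht, zero_mul]
      · have h1 := hI _ hsA _ (hcu ζ t hζ)
        rw [map_mul, map_pow, hA, eX] at h1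
        have h2 : cu ζ t (cl i) = t := by simp [cu, mkU_cl]
        rw [h2] at h1
        have h3 : ((r : K) * ((t ^ d i) ^ α) ^ (r - 1)) ^ k ≠ 0 := by
          exact pow_ne_zero _ (mul_ne_zero hrK (pow_ne_zero _ (pow_ne_zero _ (pow_ne_zero _ ht))))
        rw [(mul_eq_zero.1 h1).resolve_right h3, mul_zero]
    have hF0 : F = 0 := (mul_eq_zero.1 hz).resolve_left Polynomial.X_ne_zero
    have := hF 0
    rw [hF0, Polynomial.eval_zero, huniq _ (hcu ζ 0 hζ) (by simp [cu, mkU_cl]) (mkU_la hn _)] at this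
    exact hs this.symm
  have hji : j ≠ i := hij.symm
  have hcj : ∀ ζ t, cu ζ t (cl j) = ζ := by
    intro ζ t; simp [cu, mkU_cl, hji]
  rcases hfin with hfin | hfin
  · obtain ⟨s, hs, hsa⟩ := hfin (a ^ k) (Ideal.pow_mem_pow (Ideal.subset_span (by simp)) _)
    exact hcurve 1 (one_pow _) a s hs hsa fun t =>
      ea1 _ (hcu 1 t (one_pow _)) (by rw [hcj, one_pow])
  · obtain ⟨s, hs, hsa⟩ := hfin (b ^ k) (Ideal.pow_mem_pow (Ideal.subset_span (by simp)) _)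
    have : NeZero (r : K) := ⟨hrK⟩
    obtain ⟨η, hη⟩ := HasEnoughRootsOfUnity.exists_primitiveRoot K r
    obtain ⟨ζ, hζ⟩ := IsAlgClosed.exists_pow_nat_eq η hepos
    have hζd : ζ ^ d j = 1 := by rw [he, mul_comm, pow_mul, hζ, hη.pow_eq_one]
    refine hcurve ζ hζd b s hs hsa fun t => ?_
    rw [eb, ea0 _ (hcu ζ t hζd), sub_zero]
    rw [hcj, hζ]
    exact hη.ne_one hr.one_lt

end main_part

end ToricAux

/-- There do not exist `n` polynomials in `K[x_1,…,x_n,y_1,…,y_n]` whose common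
zero set in `K^{2n}` is exactly `V`; in particular `ara V ≥ n + 1`. -/
theorem toric_ara_ge_n_add_one
    (K : Type*) [Field K] [IsAlgClosed K]
    (n : ℕ) (hn : 3 ≤ n)
    (d f g h : Fin (n - 1) → ℕ)
    (hd : ∀ i, 0 < d i) (hf : ∀ i, 0 < f i) (hg : ∀ i, 0 < g i) (hh : ∀ i, 0 < h i)
    (hdf : ∀ i, Nat.Coprime (d i) (f i))
    (hdh : ∀ i, Nat.Coprime (d i) (h i))
    (hdd : ∀ i j, i ≠ j → Nat.Coprime (d i) (d j))
    (p q : ℕ) (hp : p.Prime) (hq : q.Prime) (hpq : p ≠ q)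
    (i₀ j₀ : Fin (n - 1)) (hpd : p ∣ d i₀) (hqd : q ∣ d j₀) :
    ¬ ∃ P : Fin n → MvPolynomial (Fin n ⊕ Fin n) K,
      {w : Fin n ⊕ Fin n → K | ∀ k, MvPolynomial.eval w (P k) = 0}
        = Set.range (phiMap n d f g h) := by
  rintro ⟨G, hG⟩
  have main : ∀ r : ℕ, r.Prime → (r : K) ≠ 0 → ∀ j : Fin (n - 1), r ∣ d j → False := by
    intro r hr hrK j hrd
    have : Nontrivial (Fin (n - 1)) := Fin.nontrivial_iff_two_le.2 (by omega)
    obtain ⟨i, hij⟩ := exists_ne j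
    exact ToricAux.main_aux d f g h hn hd hg hh hdf hdh hdd r hr hrK i j hij hrd G hG
  by_cases hpK : (p : K) = 0
  · refine main q hq ?_ j₀ hqd
    intro hqK
    have h1 : ((1 : ℕ) : K) = 0 := by
      have hco : Nat.Coprime p q := (Nat.coprime_primes hp hq).2 hpq
      obtain ⟨c, hc⟩ := CharP.exists K
      rw [CharP.cast_eq_zero_iff K c] at hpK hqK ⊢
      rw [← hco]; exact Nat.dvd_gcd hpK hqK
    simp at h1
  · exact main p hp hpK i₀ hpd
end
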